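/- arXiv:2410.14063 — 8 statements merged into one kernel-verified Lean document; each statement's English description precedes it below -/
import Mathlib

section
/- For every integer d ≥ 3 and every natural number N, there exists a d-regular nut graph with more than N vertices. In other words, for each degree d ≥ 3 there exist infinitely many d-regular nut graphs. -/
open SimpleGraph Matrix Module

open Classical in
/-- The real adjacency matrix of a simple graph. -/
noncomputable def adjMatR {V : Type*} [Fintype V] (G : SimpleGraph V) : Matrix V V ℝ :=
  Matrix.of fun u v => if G.Adj u v then (1 : ℝ) else 0

/-- A nut graph: the kernel of the real adjacency matrix is one-dimensional and every
nonzero kernel vector has all entries nonzero. -/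
def IsNutGraph {V : Type*} [Fintype V] (G : SimpleGraph V) : Prop :=
  Module.finrank ℝ (LinearMap.ker (adjMatR G).mulVecLin) = 1 ∧
    ∀ x : V → ℝ, (adjMatR G).mulVec x = 0 → x ≠ 0 → ∀ v, x v ≠ 0

/-- A graph is `d`-regular if every vertex has exactly `d` neighbours. -/
def IsRegularOfDeg {V : Type*} (G : SimpleGraph V) (d : ℕ) : Prop :=
  ∀ v, (G.neighborSet v).ncard = d

/-- The circulant graph `Circ(n, S)` on vertex set `ℤ_n`. -/
def Circ (n : ℕ) (S : Finset ℕ) : SimpleGraph (ZMod n) :=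
  SimpleGraph.circulantGraph ((fun k : ℕ => (k : ZMod n)) '' (S : Set ℕ))

/-- The Cayley graph `Cay(Γ, C)` (for `C` inversion-closed with `1 ∉ C`). -/
def cayleyGraph {Γ : Type*} [Group Γ] (C : Set Γ) : SimpleGraph Γ :=
  SimpleGraph.fromRel (fun u v => v * u⁻¹ ∈ C)

/-- Additive version of the Cayley graph. -/
def addCayleyGraph {Γ : Type*} [AddGroup Γ] (C : Set Γ) : SimpleGraph Γ :=
  SimpleGraph.fromRel (fun u v => v - u ∈ C)

/-- A graph is a Cayley graph if it is isomorphic to `Cay(Γ, C)` for some finite group `Γ`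
and some inversion-closed connection set `C ⊆ Γ \ {1}`. -/
def IsCayleyGraph {V : Type u} (G : SimpleGraph V) : Prop :=
  ∃ (Γ : Type u) (_ : Group Γ) (_ : Fintype Γ) (C : Set Γ),
    (1 : Γ) ∉ C ∧ (∀ c ∈ C, c⁻¹ ∈ C) ∧ Nonempty (G ≃g cayleyGraph C)

/-- A `d`-regular weighted graph (a loopless multigraph, `W u v` being the number of edges joining
`u` and `v`) whose weight matrix has a kernel spanned by a single nowhere-zero vector. -/
structure IsRegularNutWeight {V : Type} [Fintype V] (W : V → V → ℕ) (d : ℕ) : Prop where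
  symm : ∀ u v, W u v = W v u
  loopless : ∀ v, W v v = 0
  degree : ∀ v, ∑ w, (W v w : ℝ) = d
  nut : ∃ k : V → ℝ, (∀ v, k v ≠ 0) ∧ (∀ v, ∑ w, (W v w : ℝ) * k w = 0) ∧
    ∀ x : V → ℝ, (∀ v, ∑ w, (W v w : ℝ) * x w = 0) → ∃ c : ℝ, ∀ v, x v = c * k v

/-- The edges leaving `v` in the multigraph with weights `W`. -/
abbrev EdgesAt {V : Type} (W : V → V → ℕ) (v : V) : Type := Σ u : V, Fin (W v u)

lemma EdgesAt.fst_ne {V : Type} {W : V → V → ℕ} {v : V} (hv : W v v = 0) (e : EdgesAt W v) :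
    e.1 ≠ v := by
  intro h
  have i := e.2
  rw [h, hv] at i
  exact i.elim0

/-- The Fowler construction at the vertex `v` of a multigraph. Each edge `e` from `v` to `u` is
replaced by two new vertices `q e = inr (inl e)` and `p e = inr (inr e)` with `v ~ q e`,
`p e ~ u`, and `q e ~ p f` for `e ≠ f`. -/
def fowlerWeight {V : Type} [DecidableEq V] (W : V → V → ℕ) (v : V) :
    V ⊕ EdgesAt W v ⊕ EdgesAt W v → V ⊕ EdgesAt W v ⊕ EdgesAt W v → ℕ
  | .inl a, .inl b => if a = v ∨ b = v then 0 else W a b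
  | .inl a, .inr (.inl _) => if a = v then 1 else 0
  | .inl a, .inr (.inr e) => if e.1 = a then 1 else 0
  | .inr (.inl _), .inl a => if a = v then 1 else 0
  | .inr (.inl _), .inr (.inl _) => 0
  | .inr (.inl e), .inr (.inr f) => if e = f then 0 else 1
  | .inr (.inr e), .inl a => if e.1 = a then 1 else 0
  | .inr (.inr e), .inr (.inl f) => if e = f then 0 else 1
  | .inr (.inr _), .inr (.inr _) => 0

lemma sum_ite_eq_zero_one_mul {E : Type} [Fintype E] [DecidableEq E] (e : E) (g : E → ℝ) :
    ∑ f, (((if e = f then 0 else 1 : ℕ) : ℝ)) * g f = ∑ f, g f - g e := by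
  have h : ∀ f, (((if e = f then 0 else 1 : ℕ) : ℝ)) * g f = g f - if e = f then g f else 0 := by
    intro f
    split_ifs <;> simp
  simp only [h, Finset.sum_sub_distrib, Finset.sum_ite_eq, Finset.mem_univ, if_true]

section Fowler

variable {V : Type} [Fintype V] {W : V → V → ℕ} {v : V}

lemma sum_edgesAt (f : V → ℝ) : ∑ e : EdgesAt W v, f e.1 = ∑ u, (W v u : ℝ) * f u := by
  simp [Fintype.sum_sigma]

lemma IsRegularNutWeight.card_edgesAt {d : ℕ} (h : IsRegularNutWeight W d) :
    Fintype.card (EdgesAt W v) = d := by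
  have := h.degree v
  rw [← Nat.cast_sum] at this
  simpa using Nat.cast_injective this

variable [DecidableEq V]

lemma sum_fowlerWeight_center (x : V ⊕ EdgesAt W v ⊕ EdgesAt W v → ℝ) (hv : W v v = 0) :
    ∑ w, (fowlerWeight W v (.inl v) w : ℝ) * x w = ∑ e, x (.inr (.inl e)) := by
  simp [Fintype.sum_sum_type, fowlerWeight, EdgesAt.fst_ne hv]

lemma sum_fowlerWeight_old (x : V ⊕ EdgesAt W v ⊕ EdgesAt W v → ℝ) {a : V} (ha : a ≠ v) :
    ∑ w, (fowlerWeight W v (.inl a) w : ℝ) * x w =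
      (∑ b, (W a b : ℝ) * if b = v then 0 else x (.inl b)) +
        ∑ e : EdgesAt W v, if e.1 = a then x (.inr (.inr e)) else 0 := by
  simp [Fintype.sum_sum_type, fowlerWeight, ha]

lemma sum_fowlerWeight_q (x : V ⊕ EdgesAt W v ⊕ EdgesAt W v → ℝ) (e : EdgesAt W v) :
    ∑ w, (fowlerWeight W v (.inr (.inl e)) w : ℝ) * x w =
      x (.inl v) + (∑ f, x (.inr (.inr f)) - x (.inr (.inr e))) := by
  rw [← sum_ite_eq_zero_one_mul e (fun f => x (.inr (.inr f)))]
  simp [Fintype.sum_sum_type, fowlerWeight]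

lemma sum_fowlerWeight_p (x : V ⊕ EdgesAt W v ⊕ EdgesAt W v → ℝ) (e : EdgesAt W v) :
    ∑ w, (fowlerWeight W v (.inr (.inr e)) w : ℝ) * x w =
      x (.inl e.1) + (∑ f, x (.inr (.inl f)) - x (.inr (.inl e))) := by
  rw [← sum_ite_eq_zero_one_mul e (fun f => x (.inr (.inl f)))]
  simp [Fintype.sum_sum_type, fowlerWeight]

/-- Splitting off the contribution of `v` to a row of the weight matrix. -/
lemma sum_erase_add_edgesAt (hs : ∀ u w, W u w = W w u) (a : V) (g : V → ℝ) :
    (∑ b, (W a b : ℝ) * if b = v then 0 else g b) +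
        (∑ e : EdgesAt W v, if e.1 = a then g v else 0) = ∑ b, (W a b : ℝ) * g b := by
  rw [sum_edgesAt (fun u => if u = a then g v else 0)]
  have h : ∀ b, (W a b : ℝ) * (if b = v then 0 else g b) =
      (W a b : ℝ) * g b - if b = v then (W a v : ℝ) * g v else 0 := by
    intro b
    split_ifs with hb
    · subst hb; ring
    · ring
  simp only [h, Finset.sum_sub_distrib]
  simp [hs v a]

theorem IsRegularNutWeight.fowler {d : ℕ} (h : IsRegularNutWeight W d) (hd : 2 ≤ d) (v : V) :
    IsRegularNutWeight (fowlerWeight W v) d := by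
  have hv := h.loopless v
  have hcard : (Fintype.card (EdgesAt W v) : ℝ) = d := by rw [h.card_edgesAt]
  have hd' : (d : ℝ) - 1 ≠ 0 := by
    have : (2 : ℝ) ≤ d := by exact_mod_cast hd
    linarith
  refine ⟨?_, ?_, ?_, ?_⟩
  · rintro (a | e | e) (b | f | f) <;> simp [fowlerWeight, h.symm, or_comm, eq_comm]
  · rintro (a | e | e) <;> simp [fowlerWeight, h.loopless]
  · intro u
    have hone : ∑ w, (fowlerWeight W v u w : ℝ) =
        ∑ w, (fowlerWeight W v u w : ℝ) * (fun _ => (1 : ℝ)) w := by simp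
    rw [hone]
    rcases u with a | e | e
    · by_cases ha : a = v
      · subst ha
        rw [sum_fowlerWeight_center _ hv]
        simp only [Finset.sum_const, Finset.card_univ, nsmul_eq_mul, hcard, mul_one]
      · rw [sum_fowlerWeight_old _ ha, sum_erase_add_edgesAt h.symm a (fun _ => 1)]
        simpa using h.degree a
    · rw [sum_fowlerWeight_q]
      simp only [Finset.sum_const, Finset.card_univ, nsmul_eq_mul, hcard]
      ring
    · rw [sum_fowlerWeight_p]
      simp only [Finset.sum_const, Finset.card_univ, nsmul_eq_mul, hcard]
      ring
  · obtain ⟨k, hk0, hk, huniq⟩ := h.nut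
    refine ⟨Sum.elim (fun a => if a = v then -((d : ℝ) - 1) * k v else k a)
      (Sum.elim (fun e => k e.1) (fun _ => k v)), ?_, ?_, ?_⟩
    · rintro (a | e | e)
      · by_cases ha : a = v
        · simpa [ha] using mul_ne_zero (neg_ne_zero.mpr hd') (hk0 v)
        · simp [ha, hk0]
      · simp [hk0]
      · simp [hk0]
    · have hQ : ∑ e : EdgesAt W v, k e.1 = 0 := by rw [sum_edgesAt, hk]
      rintro (a | e | e)
      · by_cases ha : a = v
        · subst ha
          rw [sum_fowlerWeight_center _ hv]
          simpa using hQ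
        · rw [sum_fowlerWeight_old _ ha]
          refine Eq.trans ?_ ((sum_erase_add_edgesAt (v := v) h.symm a k).trans (hk a))
          congr 1
          refine Finset.sum_congr rfl fun b _ => ?_
          by_cases hb : b = v <;> simp [hb]
      · rw [sum_fowlerWeight_q]
        simp only [Sum.elim_inl, Sum.elim_inr, if_true, Finset.sum_const, Finset.card_univ,
          nsmul_eq_mul, hcard]
        ring
      · rw [sum_fowlerWeight_p]
        simp [EdgesAt.fst_ne hv, hQ]
    · intro x hx
      set s : ℝ := x (.inl v) + ∑ f, x (.inr (.inr f)) with hs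
      have hP : ∀ e, x (.inr (.inr e)) = s := by
        intro e
        have := hx (.inr (.inl e))
        rw [sum_fowlerWeight_q] at this
        linarith
      have hxv : x (.inl v) = -((d : ℝ) - 1) * s := by
        have h2 : ∑ f : EdgesAt W v, x (.inr (.inr f)) = d * s := by
          simp only [hP, Finset.sum_const, Finset.card_univ, nsmul_eq_mul, hcard]
        rw [h2] at hs
        linarith
      have hQ0 : ∑ e, x (.inr (.inl e)) = 0 := by
        rw [← sum_fowlerWeight_center _ hv, hx]
      have hQ : ∀ e, x (.inr (.inl e)) = x (.inl e.1) := by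
        intro e
        have := hx (.inr (.inr e))
        rw [sum_fowlerWeight_p, hQ0] at this
        linarith
      set y : V → ℝ := fun a => if a = v then s else x (.inl a) with hy
      have hyv : y v = s := by simp [hy]
      have hyne : ∀ a, a ≠ v → y a = x (.inl a) := fun a ha => by simp [hy, ha]
      obtain ⟨c, hc⟩ := huniq y (by
        intro a
        by_cases ha : a = v
        · subst ha
          rw [← sum_edgesAt, ← hQ0]
          exact Finset.sum_congr rfl fun e _ => by
            rw [hQ, hyne _ (EdgesAt.fst_ne hv e)]
        · rw [← sum_erase_add_edgesAt (v := v) h.symm a y]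
          refine Eq.trans ?_ ((sum_fowlerWeight_old x ha).symm.trans (hx (.inl a)))
          congr 1
          · refine Finset.sum_congr rfl fun b _ => ?_
            by_cases hb : b = v <;> simp [hb, hyne]
          · simp only [hP, hyv])
      refine ⟨c, ?_⟩
      rintro (a | e | e)
      · by_cases ha : a = v
        · subst ha
          simp only [Sum.elim_inl, if_true, hxv, ← hyv, hc]
          ring
        · simp [ha, ← hc, hyne]
      · simp [hQ, ← hc, hyne _ (EdgesAt.fst_ne hv e)]
      · simp [hP, ← hc, hyv]

end Fowler

/-- Fowler's construction at every vertex incident to a multiple edge removes all of them. -/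
lemma exists_simple_of_card {d : ℕ} (hd : 2 ≤ d) (m : ℕ) :
    ∀ (V : Type) [Fintype V] [Nonempty V] (W : V → V → ℕ) (S : Finset V),
      IsRegularNutWeight W d → (∀ a b, a ∉ S → W a b ≤ 1) → S.card = m →
      ∃ (V' : Type) (_ : Fintype V') (_ : Nonempty V') (W' : V' → V' → ℕ),
        IsRegularNutWeight W' d ∧ ∀ a b, W' a b ≤ 1 := by
  classical
  induction m with
  | zero =>
    intro V _ _ W S hW hS hm
    rw [Finset.card_eq_zero] at hm
    subst hm
    exact ⟨V, inferInstance, inferInstance, W, hW, fun a b => hS a b (by simp)⟩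
  | succ m ih =>
    intro V _ _ W S hW hS hm
    obtain ⟨v, hvS⟩ : S.Nonempty := by
      rw [← Finset.card_pos]; omega
    refine ih _ (fowlerWeight W v) ((S.erase v).map ⟨Sum.inl, Sum.inl_injective⟩)
      (hW.fowler hd v) ?_ (by rw [Finset.card_map, Finset.card_erase_of_mem hvS, hm]; rfl)
    rintro (a | e | e) (b | f | f) ha <;> simp only [fowlerWeight] <;>
      (try split_ifs) <;> try omega
    rename_i hab
    push Not at hab
    refine hS a b fun haS => ha ?_
    simp [haS, hab.1]

lemma exists_simple_of_lt_card {d : ℕ} (hd : 2 ≤ d) {V : Type} [Fintype V] [Nonempty V]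
    {W : V → V → ℕ} (hW : IsRegularNutWeight W d) (N : ℕ) :
    ∃ (V' : Type) (_ : Fintype V') (W' : V' → V' → ℕ), N < Fintype.card V' ∧
        IsRegularNutWeight W' d ∧ ∀ a b, W' a b ≤ 1 := by
  classical
  suffices h : ∃ (V' : Type) (_ : Fintype V') (_ : Nonempty V') (W' : V' → V' → ℕ),
      N < Fintype.card V' ∧ IsRegularNutWeight W' d ∧ ∀ a b, W' a b ≤ 1 by
    obtain ⟨V', i, _, W', h⟩ := h
    exact ⟨V', i, W', h⟩
  induction N with
  | zero =>
    obtain ⟨V', _, _, W', h⟩ :=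
      exists_simple_of_card hd _ V W Finset.univ hW (by simp) rfl
    exact ⟨V', inferInstance, inferInstance, W', Fintype.card_pos, h⟩
  | succ N ih =>
    obtain ⟨V', _, ⟨v⟩, W', hN, hW', h1⟩ := ih
    refine ⟨V' ⊕ EdgesAt W' v ⊕ EdgesAt W' v, inferInstance, ⟨.inl v⟩, fowlerWeight W' v, ?_,
      hW'.fowler hd v, ?_⟩
    · simp only [Fintype.card_sum, hW'.card_edgesAt]
      omega
    · rintro (a | e | e) (b | f | f) <;> simp only [fowlerWeight] <;>
        (try split_ifs) <;> first | omega | exact h1 _ _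

/-- On four vertices, with weights `t + 2`, `t + 1`, `1` on the three perfect matchings. -/
lemma exists_isRegularNutWeight_even (t : ℕ) :
    ∃ W : Fin 4 → Fin 4 → ℕ, IsRegularNutWeight W (2 * t + 4) := by
  refine ⟨![![0, t + 2, t + 1, 1], ![t + 2, 0, 1, t + 1], ![t + 1, 1, 0, t + 2],
    ![1, t + 1, t + 2, 0]], ?_, ?_, ?_, ![1, 1, -1, -1], ?_, ?_, ?_⟩
  · intro u v
    fin_cases u <;> fin_cases v <;> rfl
  · intro v
    fin_cases v <;> rfl
  · intro v
    fin_cases v <;> simp [Fin.sum_univ_four] <;> ring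
  · intro v
    fin_cases v <;> simp
  · intro v
    fin_cases v <;> simp [Fin.sum_univ_four] <;> ring
  · intro x hx
    have h0 := hx 0
    have h1 := hx 1
    have h2 := hx 2
    have h3 := hx 3
    simp [Fin.sum_univ_four] at h0 h1 h2 h3
    have ht1 : (t : ℝ) + 1 ≠ 0 := by positivity
    have ht2 : (t : ℝ) + 2 ≠ 0 := by positivity
    have hsum : x 0 + x 1 + x 2 + x 3 = 0 :=
      (mul_eq_zero.mp (by linear_combination h0 + h1 :
        ((t : ℝ) + 2) * (x 0 + x 1 + x 2 + x 3) = 0)).resolve_left ht2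
    have hdiff : x 0 - x 1 + x 2 - x 3 = 0 := by linear_combination (h1 - h0 + h3 - h2) / 2
    have heq : x 0 - x 1 = 0 :=
      (mul_eq_zero.mp (by linear_combination (h1 - h0 + t * hdiff) / 2 :
        ((t : ℝ) + 1) * (x 0 - x 1) = 0)).resolve_left ht1
    refine ⟨x 0, fun v => ?_⟩
    fin_cases v <;> simp <;> linarith

/-- Two adjacent hubs, each joined to `2 m` further vertices that are matched in pairs by edges of
weight `2 m`. -/
def hubWeight (m : ℕ) : Bool × Option (Fin m × Bool) → Bool × Option (Fin m × Bool) → ℕ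
  | (s, none), (t, none) => if s = t then 0 else 1
  | (s, none), (t, some _) => if s = t then 1 else 0
  | (s, some _), (t, none) => if s = t then 1 else 0
  | (s, some (i, b)), (t, some (j, c)) => if s = t ∧ i = j ∧ b = !c then 2 * m else 0

lemma sum_hubWeight_none (m : ℕ) (s : Bool) (x : Bool × Option (Fin m × Bool) → ℝ) :
    ∑ w, (hubWeight m (s, none) w : ℝ) * x w =
      x (!s, none) + ∑ i, (x (s, some (i, true)) + x (s, some (i, false))) := by
  cases s <;> simp [Fintype.sum_prod_type, Fintype.sum_option, hubWeight, add_comm]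

lemma sum_hubWeight_some (m : ℕ) (s : Bool) (i : Fin m) (b : Bool)
    (x : Bool × Option (Fin m × Bool) → ℝ) :
    ∑ w, (hubWeight m (s, some (i, b)) w : ℝ) * x w =
      x (s, none) + 2 * m * x (s, some (i, !b)) := by
  cases s <;> cases b <;>
    simp [Fintype.sum_prod_type, Fintype.sum_option, hubWeight, add_comm]

lemma isRegularNutWeight_hubWeight {m : ℕ} (hm : 0 < m) :
    IsRegularNutWeight (hubWeight m) (2 * m + 1) := by
  have hm' : (m : ℝ) ≠ 0 := by positivity
  refine ⟨?_, ?_, ?_, fun w => if w.2 = none then 2 * m else -1, ?_, ?_, ?_⟩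
  · rintro ⟨s, _ | ⟨i, b⟩⟩ ⟨t, _ | ⟨j, c⟩⟩ <;> cases s <;> cases t <;>
      simp [hubWeight, eq_comm]
    all_goals cases b <;> cases c <;> simp
  · rintro ⟨s, _ | ⟨i, b⟩⟩ <;> simp [hubWeight]
  · intro v
    have hone : ∑ w, (hubWeight m v w : ℝ) =
        ∑ w, (hubWeight m v w : ℝ) * (fun _ => (1 : ℝ)) w := by simp
    rw [hone]
    obtain ⟨s, _ | ⟨i, b⟩⟩ := v
    · rw [sum_hubWeight_none]
      simp
      ring
    · rw [sum_hubWeight_some]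
      simp
      ring
  · intro v
    dsimp only
    split_ifs <;> simp [hm']
  · rintro ⟨s, _ | ⟨i, b⟩⟩
    · rw [sum_hubWeight_none]
      simp
      ring
    · rw [sum_hubWeight_some]
      simp
  · intro x hx
    have hsome : ∀ s i b, x (s, some (i, b)) = -x (s, none) / (2 * m) := by
      intro s i b
      have := hx (s, some (i, !b))
      rw [sum_hubWeight_some, Bool.not_not] at this
      field_simp
      linarith
    have hnone : ∀ s, x (s, none) = x (true, none) := by
      intro s
      cases s
      · have := hx (true, none)
        rw [sum_hubWeight_none] at this
        simp only [hsome, Finset.sum_const, Finset.card_univ, Fintype.card_fin, nsmul_eq_mul,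
          Bool.not_true] at this
        field_simp at this
        linarith
      · rfl
    refine ⟨x (true, none) / (2 * m), ?_⟩
    rintro ⟨s, _ | ⟨i, b⟩⟩
    · simp only [if_true, hnone s]
      field_simp
    · rw [hsome, hnone]
      simp
      ring

lemma exists_isRegularNutWeight {d : ℕ} (hd : 3 ≤ d) :
    ∃ (V : Type) (_ : Fintype V) (_ : Nonempty V) (W : V → V → ℕ), IsRegularNutWeight W d := by
  rcases Nat.even_or_odd' d with ⟨m, rfl | rfl⟩
  · obtain ⟨t, rfl⟩ : ∃ t, m = t + 2 := ⟨m - 2, by omega⟩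
    obtain ⟨W, hW⟩ := exists_isRegularNutWeight_even t
    exact ⟨Fin 4, inferInstance, inferInstance, W, hW⟩
  · exact ⟨_, inferInstance, ⟨(true, none)⟩, hubWeight m,
      isRegularNutWeight_hubWeight (by omega)⟩

lemma IsRegularNutWeight.equiv {V V' : Type} [Fintype V] [Fintype V'] {W : V → V → ℕ} {d : ℕ}
    (h : IsRegularNutWeight W d) (e : V' ≃ V) :
    IsRegularNutWeight (fun a b => W (e a) (e b)) d := by
  refine ⟨fun _ _ => h.symm _ _, fun _ => h.loopless _, fun v => ?_, ?_⟩
  · rw [← h.degree (e v)]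
    exact e.sum_comp (fun w => (W (e v) w : ℝ))
  · obtain ⟨k, hk0, hk, huniq⟩ := h.nut
    refine ⟨k ∘ e, fun v => hk0 _, fun v => ?_, fun x hx => ?_⟩
    · rw [← hk (e v)]
      exact e.sum_comp (fun w => (W (e v) w : ℝ) * k w)
    · obtain ⟨c, hc⟩ := huniq (x ∘ e.symm) (fun v => by
        rw [← hx (e.symm v), ← e.sum_comp]
        simp)
      exact ⟨c, fun v => by simpa using hc (e v)⟩

/-- The simple graph underlying a weight function. -/
def weightGraph {V : Type} (W : V → V → ℕ) (hs : ∀ u v, W u v = W v u) (hl : ∀ v, W v v = 0) :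
    SimpleGraph V where
  Adj u v := W u v = 1
  symm := ⟨fun u v h => by rw [hs]; exact h⟩
  loopless := ⟨fun v h => by simp [hl] at h⟩

lemma IsRegularNutWeight.adjMatR_weightGraph {V : Type} [Fintype V] {W : V → V → ℕ} {d : ℕ}
    (h : IsRegularNutWeight W d) (h1 : ∀ a b, W a b ≤ 1) (a b : V) :
    adjMatR (weightGraph W h.symm h.loopless) a b = W a b := by
  have := h1 a b
  simp only [adjMatR, Matrix.of_apply, weightGraph]
  split_ifs with hab
  · simp [hab]
  · have : W a b = 0 := by omega
    simp [this]

lemma IsRegularNutWeight.isRegularOfDeg {V : Type} [Fintype V] {W : V → V → ℕ} {d : ℕ}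
    (h : IsRegularNutWeight W d) (h1 : ∀ a b, W a b ≤ 1) :
    IsRegularOfDeg (weightGraph W h.symm h.loopless) d := by
  classical
  intro v
  have hset : (weightGraph W h.symm h.loopless).neighborSet v =
      ((Finset.univ.filter fun w => W v w = 1 : Finset V) : Set V) := by
    ext w
    simp [weightGraph]
  rw [hset, Set.ncard_coe_finset, Finset.card_filter]
  have hd := h.degree v
  rw [← Nat.cast_sum] at hd
  rw [← Nat.cast_injective hd]
  refine Finset.sum_congr rfl fun w _ => ?_
  have := h1 v w
  split_ifs <;> omega

lemma IsRegularNutWeight.isNutGraph {V : Type} [Fintype V] [Nonempty V] {W : V → V → ℕ} {d : ℕ}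
    (h : IsRegularNutWeight W d) (h1 : ∀ a b, W a b ≤ 1) :
    IsNutGraph (weightGraph W h.symm h.loopless) := by
  obtain ⟨k, hk0, hk, huniq⟩ := h.nut
  have hmul : ∀ (x : V → ℝ) (v : V),
      (adjMatR (weightGraph W h.symm h.loopless)).mulVec x v = ∑ w, (W v w : ℝ) * x w := by
    intro x v
    simp [Matrix.mulVec, dotProduct, h.adjMatR_weightGraph h1]
  have hspan : ∀ x : V → ℝ, (adjMatR (weightGraph W h.symm h.loopless)).mulVec x = 0 →
      ∃ c : ℝ, ∀ v, x v = c * k v := fun x hx =>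
    huniq x fun v => by rw [← hmul, hx]; rfl
  have hkker : (adjMatR (weightGraph W h.symm h.loopless)).mulVec k = 0 := by
    ext v
    rw [hmul, hk]; rfl
  constructor
  · rw [finrank_eq_one_iff']
    refine ⟨⟨k, by simpa using hkker⟩, ?_, ?_⟩
    · obtain ⟨v⟩ := ‹Nonempty V›
      intro h0
      exact hk0 v (congrFun (congrArg Subtype.val h0) v)
    · rintro ⟨x, hx⟩
      obtain ⟨c, hc⟩ := hspan x (by simpa using hx)
      exact ⟨c, Subtype.ext (funext fun v => (hc v).symm)⟩
  · intro x hx hx0 v hv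
    obtain ⟨c, hc⟩ := hspan x hx
    apply hx0
    rw [hc v] at hv
    have hc0 : c = 0 := (mul_eq_zero.mp hv).resolve_right (hk0 v)
    ext w
    simp [hc w, hc0]

/-- For each degree `d ≥ 3` there exist infinitely many `d`-regular nut graphs:
for every `N` there is a `d`-regular nut graph with more than `N` vertices. -/
theorem infinitely_many_regular_nut_graphs (d : ℕ) (hd : 3 ≤ d) (N : ℕ) :
    ∃ n : ℕ, N < n ∧ ∃ G : SimpleGraph (Fin n), IsRegularOfDeg G d ∧ IsNutGraph G := by
  obtain ⟨V, _, _, W, hW⟩ := exists_isRegularNutWeight hd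
  obtain ⟨V', _, W', hN, hW', h1⟩ := exists_simple_of_lt_card (by omega) hW N
  have hW'' := hW'.equiv (Fintype.equivFin V').symm
  have : Nonempty (Fin (Fintype.card V')) := ⟨⟨0, by omega⟩⟩
  exact ⟨Fintype.card V', hN, _, hW''.isRegularOfDeg fun _ _ => h1 _ _,
    hW''.isNutGraph fun _ _ => h1 _ _⟩
end

section
/- For every even integer d ≥ 4 and every natural number N, there exists a d-regular Cayley nut graph with more than N vertices. In other words, for each even degree d ≥ 4 there exist infinitely many d-regular Cayley nut graphs. -/
open SimpleGraph Matrix Module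

/-- A graph whose adjacency kernel is spanned by a nowhere-zero vector is a nut graph. -/
lemma IsNutGraph.of_span {V : Type*} [Fintype V] [Nonempty V] (G : SimpleGraph V) (w : V → ℝ)
    (hw : ∀ v, w v ≠ 0) (hker : (adjMatR G).mulVec w = 0)
    (hspan : ∀ x, (adjMatR G).mulVec x = 0 → ∃ c : ℝ, x = c • w) : IsNutGraph G := by
  constructor
  · rw [finrank_eq_one_iff']
    refine ⟨⟨w, by simpa using hker⟩, ?_, ?_⟩
    · intro h
      obtain ⟨v⟩ := ‹Nonempty V›
      exact hw v (congrFun (congrArg Subtype.val h) v)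
    · rintro ⟨x, hx⟩
      obtain ⟨c, hc⟩ := hspan x (by simpa using hx)
      exact ⟨c, Subtype.ext hc.symm⟩
  · intro x hx hx0 v
    obtain ⟨c, rfl⟩ := hspan x hx
    have hc : c ≠ 0 := by
      rintro rfl
      simp at hx0
    simpa using ⟨hc, hw v⟩

/-- A criterion for a Cayley graph of an additive group, with an injectively indexed connection
set, to be a nut graph. -/
lemma exists_cayley_nut_graph {H I : Type} [AddCommGroup H] [Fintype H] [Fintype I] (φ : I → H)
    (hinj : Function.Injective φ) (h0 : ∀ i, φ i ≠ 0) (hneg : ∀ i, ∃ j, φ j = -φ i)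
    (w : H → ℝ) (hw : ∀ h, w h ≠ 0) (hker : ∀ u, ∑ i, w (φ i + u) = 0)
    (hspan : ∀ x : H → ℝ, (∀ u, ∑ i, x (φ i + u) = 0) → ∃ c : ℝ, x = c • w) :
    ∃ G : SimpleGraph (Fin (Fintype.card H)),
      IsRegularOfDeg G (Fintype.card I) ∧ IsNutGraph G ∧ IsCayleyGraph G := by
  classical
  let C : Set (Multiplicative H) := Set.range fun i => Multiplicative.ofAdd (φ i)
  let e : Fin (Fintype.card H) ≃ Multiplicative H :=
    (Fintype.equivFin H).symm.trans Multiplicative.ofAdd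
  have hadj : ∀ u v, (cayleyGraph C).Adj u v ↔ ∃ i, v = Multiplicative.ofAdd (φ i) * u := by
    intro u v
    simp only [cayleyGraph, SimpleGraph.fromRel_adj, C, Set.mem_range]
    constructor
    · rintro ⟨-, ⟨i, hi⟩ | ⟨i, hi⟩⟩
      · exact ⟨i, by simp [hi]⟩
      · obtain ⟨j, hj⟩ := hneg i
        exact ⟨j, by simp [hj, hi]⟩
    · rintro ⟨i, rfl⟩
      refine ⟨?_, Or.inl ⟨i, by simp⟩⟩
      intro h
      apply h0 i
      simpa using h
  have hinj' : ∀ u, Function.Injective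
      fun i => e.symm (Multiplicative.ofAdd (φ i) * e u) := by
    intro u i j h
    apply hinj
    simpa using h
  let G : SimpleGraph (Fin (Fintype.card H)) := (cayleyGraph C).comap e
  have hG : ∀ u v, G.Adj u v ↔ ∃ i, e.symm (Multiplicative.ofAdd (φ i) * e u) = v := by
    intro u v
    simp only [G, SimpleGraph.comap_adj, hadj, Equiv.symm_apply_eq]
    exact exists_congr fun i => eq_comm
  have hmul : ∀ (x : Fin (Fintype.card H) → ℝ) u, (adjMatR G).mulVec x u =
      ∑ i, x (e.symm (Multiplicative.ofAdd (φ i) * e u)) := by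
    intro x u
    rw [← Finset.sum_image (s := Finset.univ) (f := x) (fun i _ j _ h => hinj' u h)]
    simp only [Matrix.mulVec, dotProduct, adjMatR, Matrix.of_apply, ite_mul, one_mul, zero_mul]
    rw [← Finset.sum_filter]
    apply Finset.sum_congr _ fun _ _ => rfl
    ext v
    simp [hG]
  refine ⟨G, ?_, ?_, ?_⟩
  · intro u
    have : G.neighborSet u = Set.range fun i => e.symm (Multiplicative.ofAdd (φ i) * e u) := by
      ext v
      simp [hG]
    rw [this, Set.ncard_range_of_injective (hinj' u), Nat.card_eq_fintype_card]
  · have : Nonempty (Fin (Fintype.card H)) := ⟨e.symm 1⟩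
    refine IsNutGraph.of_span G (fun v => w (e v).toAdd) (fun v => hw _) ?_ ?_
    · ext u
      simpa [hmul] using hker (e u).toAdd
    · intro x hx
      obtain ⟨c, hc⟩ := hspan (fun h => x (e.symm (Multiplicative.ofAdd h))) (by
        intro u
        simpa [hmul] using congrFun hx (e.symm (Multiplicative.ofAdd u)))
      refine ⟨c, ?_⟩
      ext v
      simpa using congrFun hc (e v).toAdd
  · refine ⟨Multiplicative H, inferInstance, inferInstance, C, ?_, ?_, ⟨⟨e, ?_⟩⟩⟩
    · rintro ⟨i, hi⟩
      exact h0 i (by simpa using hi)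
    · rintro _ ⟨i, rfl⟩
      obtain ⟨j, hj⟩ := hneg i
      exact ⟨j, by simp [hj]⟩
    · simp [G]

/-- The translation operator on real functions on `ZMod n`. -/
noncomputable def zmodShift (n : ℕ) : (ZMod n → ℝ) →ₗ[ℝ] (ZMod n → ℝ) :=
  LinearMap.funLeft ℝ ℝ (· + 1)

lemma zmodShift_pow_apply {n : ℕ} (k : ℕ) (y : ZMod n → ℝ) (j : ZMod n) :
    (zmodShift n ^ k) y j = y (j + k) := by
  induction k generalizing j with
  | zero => simp
  | succ k ih =>
    rw [pow_succ', Module.End.mul_apply]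
    change (zmodShift n ^ k) y (j + 1) = _
    rw [ih]
    push_cast
    ring_nf

/-- A nonzero rational polynomial of degree less than `p - 1` in the translation operator of
`ZMod p` annihilates only translation-invariant functions. -/
lemma zmodShift_invariant_of_aeval_eq_zero {p : ℕ} (hp : p.Prime) {P : Polynomial ℚ} (hP : P ≠ 0)
    (hdeg : P.natDegree < p - 1) (y : ZMod p → ℝ)
    (hy : Polynomial.aeval (zmodShift p) (P.map (algebraMap ℚ ℝ)) y = 0) (j : ZMod p) :
    y j = y 0 := by
  have := Fact.mk hp
  have hcop : IsCoprime P (Polynomial.cyclotomic p ℚ) := by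
    refine (((Polynomial.cyclotomic.irreducible_rat hp.pos).coprime_iff_not_dvd).2 ?_).symm
    intro h
    have := Polynomial.natDegree_le_of_dvd h hP
    rw [Polynomial.natDegree_cyclotomic, Nat.totient_prime hp] at this
    omega
  obtain ⟨a, b, hab⟩ := hcop.map (Polynomial.mapRingHom (algebraMap ℚ ℝ))
  simp only [Polynomial.coe_mapRingHom, Polynomial.map_cyclotomic] at hab
  have hone : (zmodShift p ^ p - 1) y = 0 := by
    ext j
    simp [zmodShift_pow_apply]
  have key : (Polynomial.X - 1 : Polynomial ℝ) =
      (Polynomial.X - 1) * a * P.map (algebraMap ℚ ℝ) + b * (Polynomial.X ^ p - 1) := by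
    rw [← Polynomial.cyclotomic_prime_mul_X_sub_one]
    linear_combination (-(Polynomial.X - 1)) * hab
  have hinv : (zmodShift p - 1) y = 0 := by
    have h := congrArg (fun Q => Polynomial.aeval (zmodShift p) Q y) key
    simpa only [map_sub, map_add, map_mul, map_pow, Polynomial.aeval_X, map_one,
      LinearMap.add_apply, Module.End.mul_apply, hy, hone, map_zero, add_zero] using h
  have hstep : ∀ j, y (j + 1) = y j := fun j => sub_eq_zero.1 (congrFun hinv j)
  have hnat : ∀ k : ℕ, y k = y 0 := by
    intro k
    induction k with
    | zero => simp
    | succ k ih => rw [Nat.cast_succ, hstep, ih]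
  rw [← hnat j.val, ZMod.natCast_zmod_val]

/-- A convolution equation on `ZMod p` with unit coefficients off the origin has only constant
solutions. -/
lemma const_of_convolution_eq_zero {p r : ℕ} (hp : p.Prime) (hr : 0 < r) (hrp : 2 * r < p - 1)
    (e a : ℚ) (he : e ≠ 0) (y : ZMod p → ℝ)
    (hy : ∀ j, (a : ℝ) * y j +
      ∑ k ∈ Finset.range r, (e : ℝ) ^ k * (y (j + (k + 1)) + y (j - (k + 1))) = 0)
    (j : ZMod p) : y j = y 0 := by
  let P : Polynomial ℚ := Polynomial.C a * Polynomial.X ^ r + ∑ k ∈ Finset.range r,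
    Polynomial.C (e ^ k) * (Polynomial.X ^ (r + (k + 1)) + Polynomial.X ^ (r - (k + 1)))
  have hP : P ≠ 0 := by
    intro h
    have h2 : P.coeff (2 * r) = e ^ (r - 1) := by
      simp only [P, Polynomial.coeff_add, Polynomial.coeff_C_mul, Polynomial.coeff_X_pow,
        Polynomial.finsetSum_coeff]
      rw [if_neg (by omega), Finset.sum_eq_single (r - 1)]
      · rw [if_pos (by omega), if_neg (by omega)]
        simp
      · intro k hk hk'
        rw [Finset.mem_range] at hk
        rw [if_neg (by omega), if_neg (by omega)]
        simp
      · intro h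
        exact absurd (Finset.mem_range.2 (by omega)) h
    rw [h, Polynomial.coeff_zero] at h2
    exact pow_ne_zero _ he h2.symm
  have hdeg : P.natDegree ≤ 2 * r := by
    refine Polynomial.natDegree_add_le_of_degree_le ?_ ?_
    · exact (Polynomial.natDegree_C_mul_X_pow_le _ _).trans (by omega)
    · refine Polynomial.natDegree_sum_le_of_forall_le _ _ fun k hk => ?_
      rw [Finset.mem_range] at hk
      refine (Polynomial.natDegree_C_mul_le _ _).trans
        (Polynomial.natDegree_add_le_of_degree_le ?_ ?_)
      · rw [Polynomial.natDegree_X_pow]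
        omega
      · rw [Polynomial.natDegree_X_pow]
        omega
  refine zmodShift_invariant_of_aeval_eq_zero hp hP (by omega) y ?_ j
  ext j
  rw [Pi.zero_apply, ← hy (j + r)]
  simp only [P, Polynomial.map_add, Polynomial.map_mul, Polynomial.map_C, Polynomial.map_pow,
    Polynomial.map_X, Polynomial.map_sum, map_add, map_mul, map_sum, map_pow, Polynomial.aeval_X,
    Polynomial.aeval_C, LinearMap.add_apply, Module.End.mul_apply, LinearMap.sum_apply,
    Module.algebraMap_end_apply, Pi.add_apply, Pi.smul_apply, Finset.sum_apply, smul_eq_mul,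
    zmodShift_pow_apply, eq_ratCast]
  congr 1
  refine Finset.sum_congr rfl fun k hk => ?_
  rw [Finset.mem_range] at hk
  rw [← map_pow, Module.algebraMap_end_apply, Module.algebraMap_end_apply]
  simp only [Pi.smul_apply, smul_eq_mul, zmodShift_pow_apply]
  rw [Nat.cast_sub (by omega)]
  push_cast
  ring_nf

/-- An injective enumeration of a connection set of size `2 + 2 * r` in
`ZMod 2 × ZMod 2 × ZMod p`. -/
def nutConnection (p r : ℕ) : Bool ⊕ (Fin r × Bool) → ZMod 2 × ZMod 2 × ZMod p
  | .inl false => (1, 0, 0)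
  | .inl true => (0, 1, 0)
  | .inr (k, false) => ((k : ℕ), 0, (k : ℕ) + 1)
  | .inr (k, true) => ((k : ℕ), 0, -((k : ℕ) + 1))

lemma sum_nutConnection (p r : ℕ) (x : ZMod 2 × ZMod 2 × ZMod p → ℝ) (a b : ZMod 2)
    (j : ZMod p) : ∑ i, x (nutConnection p r i + (a, b, j)) =
      x (a + 1, b, j) + x (a, b + 1, j) + ∑ k ∈ Finset.range r,
        (x (a + (k : ℕ), b, j + (k + 1)) + x (a + (k : ℕ), b, j - (k + 1))) := by
  rw [Fintype.sum_sum_type, Fintype.sum_prod_type, Finset.sum_range]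
  simp only [Fintype.sum_bool, nutConnection, Prod.mk_add_mk, zero_add]
  congr 1
  · rw [add_comm, add_comm 1 a, add_comm 1 b]
  · refine Finset.sum_congr rfl fun k _ => ?_
    rw [add_comm, add_comm _ a, add_comm _ j, add_comm _ j, sub_eq_add_neg]

lemma natCast_add_natCast_ne_zero {p : ℕ} {k l : ℕ} (h : k + l + 2 < p) :
    ((k : ZMod p) + 1) + (l + 1) ≠ 0 := by
  intro h0
  have : ((k + l + 2 : ℕ) : ZMod p) = 0 := by
    push_cast
    linear_combination h0
  rw [ZMod.natCast_eq_zero_iff] at this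
  exact absurd (Nat.le_of_dvd (by omega) this) (by omega)

lemma natCast_succ_ne_zero {p : ℕ} {k : ℕ} (h : k + 1 < p) : (k : ZMod p) + 1 ≠ 0 := by
  intro h0
  have : ((k + 1 : ℕ) : ZMod p) = 0 := by exact_mod_cast h0
  rw [ZMod.natCast_eq_zero_iff] at this
  exact absurd (Nat.le_of_dvd (by omega) this) (by omega)

lemma natCast_inj_of_lt {p : ℕ} {k l : ℕ} (hk : k < p) (hl : l < p)
    (h : (k : ZMod p) = l) : k = l := by
  rw [ZMod.natCast_eq_natCast_iff'] at h
  rwa [Nat.mod_eq_of_lt hk, Nat.mod_eq_of_lt hl] at h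

lemma nutConnection_injective {p r : ℕ} (hrp : 2 * r < p) :
    Function.Injective (nutConnection p r) := by
  rintro (b | ⟨k, b⟩) (c | ⟨l, c⟩) h
  · rcases b <;> rcases c <;> simp_all [nutConnection]
  · have hl := natCast_succ_ne_zero (p := p) (k := l) (by omega)
    have := congrArg (fun z => z.2.2) h
    rcases b <;> rcases c <;> simp only [nutConnection] at this
    all_goals first
      | exact absurd (by linear_combination this) hl
      | exact absurd (by linear_combination -this) hl
  · have hk := natCast_succ_ne_zero (p := p) (k := k) (by omega)
    have := congrArg (fun z => z.2.2) h
    rcases b <;> rcases c <;> simp only [nutConnection] at this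
    all_goals first
      | exact absurd (by linear_combination this) hk
      | exact absurd (by linear_combination -this) hk
  · have hkl := natCast_add_natCast_ne_zero (p := p) (k := k) (l := l) (by omega)
    have hinj := natCast_inj_of_lt (p := p) (k := k) (l := l) (by omega) (by omega)
    have := congrArg (fun z => z.2.2) h
    rcases b <;> rcases c <;> simp only [nutConnection] at this
    · rw [Fin.ext (hinj (by linear_combination this))]
    · exact absurd (by linear_combination this) hkl
    · exact absurd (by linear_combination -this) hkl
    · rw [Fin.ext (hinj (by linear_combination -this))]

lemma nutConnection_ne_zero {p r : ℕ} (hrp : 2 * r < p) (i) : nutConnection p r i ≠ 0 := by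
  intro h
  rcases i with b | ⟨k, b⟩
  · rcases b <;> simp [nutConnection] at h
  · have hk := natCast_succ_ne_zero (p := p) (k := k) (by omega)
    have := congrArg (fun z => z.2.2) h
    rcases b <;> simp only [nutConnection, Prod.snd_zero] at this
    · exact hk this
    · exact hk (neg_eq_zero.1 this)

lemma nutConnection_neg (p r : ℕ) (i) : ∃ j, nutConnection p r j = -nutConnection p r i := by
  rcases i with (_ | _) | ⟨k, _ | _⟩
  · exact ⟨.inl false, by simp [nutConnection]⟩
  · exact ⟨.inl true, by simp [nutConnection]⟩
  · exact ⟨.inr (k, true), by simp [nutConnection]⟩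
  · exact ⟨.inr (k, false), by simp [nutConnection]⟩

/-- Projecting the kernel equation on `ZMod 2 × ZMod 2 × ZMod p` onto a pair of signs gives a
convolution equation on `ZMod p`. -/
lemma signed_sum_convolution {p r : ℕ} (x : ZMod 2 × ZMod 2 × ZMod p → ℝ)
    (hx : ∀ u, ∑ i, x (nutConnection p r i + u) = 0) (e f : ℝ) (he : e ^ 2 = 1) (hf : f ^ 2 = 1)
    (y : ZMod p → ℝ)
    (hy : ∀ j, y j = x (0, 0, j) + e * x (1, 0, j) + f * x (0, 1, j) + e * f * x (1, 1, j))
    (j : ZMod p) :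
    (e + f) * y j +
      ∑ k ∈ Finset.range r, e ^ k * (y (j + (k + 1)) + y (j - (k + 1))) = 0 := by
  have h11 : (1 : ZMod 2) + 1 = 0 := by decide
  have hsum : ∑ k ∈ Finset.range r, e ^ k * (y (j + (k + 1)) + y (j - (k + 1))) =
      ∑ k ∈ Finset.range r,
        ((x (0 + (k : ℕ), 0, j + (k + 1)) + x (0 + (k : ℕ), 0, j - (k + 1))) +
          e * (x (1 + (k : ℕ), 0, j + (k + 1)) + x (1 + (k : ℕ), 0, j - (k + 1))) +
          f * (x (0 + (k : ℕ), 1, j + (k + 1)) + x (0 + (k : ℕ), 1, j - (k + 1))) +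
          e * f * (x (1 + (k : ℕ), 1, j + (k + 1)) + x (1 + (k : ℕ), 1, j - (k + 1)))) := by
    refine Finset.sum_congr rfl fun k _ => ?_
    rw [hy, hy]
    rcases Nat.even_or_odd' k with ⟨m, rfl | rfl⟩
    · have h2 : ((2 * m : ℕ) : ZMod 2) = 0 := by
        rw [ZMod.natCast_eq_zero_iff]
        exact dvd_mul_right 2 m
      rw [h2, pow_mul, he, one_pow]
      simp only [add_zero]
      ring
    · have h2 : ((2 * m + 1 : ℕ) : ZMod 2) = 1 := by
        rw [Nat.cast_succ, (ZMod.natCast_eq_zero_iff _ _).2 (dvd_mul_right 2 m), zero_add]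
      rw [h2, pow_succ, pow_mul, he, one_pow]
      simp only [zero_add, h11]
      linear_combination (x (1, 0, j + ((2 * m + 1 : ℕ) + 1)) +
        x (1, 0, j - ((2 * m + 1 : ℕ) + 1)) + f * x (1, 1, j + ((2 * m + 1 : ℕ) + 1)) +
        f * x (1, 1, j - ((2 * m + 1 : ℕ) + 1))) * he
  rw [hsum]
  simp only [Finset.sum_add_distrib, ← Finset.mul_sum]
  have h00 := hx (0, 0, j)
  have h10 := hx (1, 0, j)
  have h01 := hx (0, 1, j)
  have h_11 := hx (1, 1, j)
  rw [sum_nutConnection] at h00 h10 h01 h_11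
  simp only [h11, zero_add, Finset.sum_add_distrib] at h00 h10 h01 h_11 ⊢
  rw [hy]
  linear_combination h00 + e * h10 + f * h01 + e * f * h_11 +
    (x (1, 0, j) + f * x (1, 1, j)) * he + (x (0, 1, j) + e * x (1, 1, j)) * hf

/-- The signed sums of a kernel vector are constant, and the constant is killed by the
corresponding eigenvalue. -/
lemma signed_sum_eq {p r : ℕ} (hp : p.Prime) (hr : 0 < r) (hrp : 2 * r < p - 1)
    (x : ZMod 2 × ZMod 2 × ZMod p → ℝ)
    (hx : ∀ u, ∑ i, x (nutConnection p r i + u) = 0) (e f : ℚ) (he : e ^ 2 = 1) (hf : f ^ 2 = 1)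
    (y : ZMod p → ℝ)
    (hy : ∀ j, y j = x (0, 0, j) + e * x (1, 0, j) + f * x (0, 1, j) + e * f * x (1, 1, j)) :
    (∀ j, y j = y 0) ∧ ((e : ℝ) + f + 2 * ∑ k ∈ Finset.range r, (e : ℝ) ^ k) * y 0 = 0 := by
  have hconv := signed_sum_convolution x hx e f (by exact_mod_cast he) (by exact_mod_cast hf) y hy
  have hconst := const_of_convolution_eq_zero hp hr hrp e (e + f)
    (by rintro rfl; norm_num at he) y (by exact_mod_cast hconv)
  refine ⟨hconst, ?_⟩
  have h := hconv 0
  rw [Finset.sum_congr rfl fun k _ => by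
    rw [hconst (0 + (k + 1)), hconst (0 - (k + 1)), ← two_mul], ← Finset.sum_mul] at h
  linear_combination h

lemma sum_neg_one_pow_range (r : ℕ) :
    2 * ∑ k ∈ Finset.range r, (-1 : ℝ) ^ k = 1 - (-1) ^ r := by
  have := mul_neg_geom_sum (-1 : ℝ) r
  linear_combination this

/-- For each even degree `d ≥ 4` there exist infinitely many `d`-regular Cayley nut graphs. -/
theorem infinitely_many_cayley_nut_graphs (d : ℕ) (hd : 4 ≤ d) (heven : Even d) (N : ℕ) :
    ∃ n : ℕ, N < n ∧ ∃ G : SimpleGraph (Fin n),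
      IsRegularOfDeg G d ∧ IsNutGraph G ∧ IsCayleyGraph G := by
  obtain ⟨m, rfl⟩ := heven
  obtain ⟨r, rfl⟩ : ∃ r, m = r + 1 := ⟨m - 1, by omega⟩
  have hr : 0 < r := by omega
  obtain ⟨p, hpN, hp⟩ := Nat.exists_infinite_primes (N + 2 * r + 2)
  have := Fact.mk hp
  have hs : ((-1 : ℝ) ^ r) ^ 2 = 1 := by rw [← pow_mul, mul_comm, pow_mul]; simp
  have hsQ : ((-1 : ℚ) ^ r) ^ 2 = 1 := by rw [← pow_mul, mul_comm, pow_mul]; simp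
  have hs0 : (-1 : ℝ) ^ r ≠ 0 := pow_ne_zero _ (by norm_num)
  have hsum := sum_neg_one_pow_range r
  set s : ℝ := (-1) ^ r with hs_def
  have hcard : Fintype.card (ZMod 2 × ZMod 2 × ZMod p) = 4 * p := by
    simp only [Fintype.card_prod, ZMod.card]
    ring
  have hdeg : Fintype.card (Bool ⊕ (Fin r × Bool)) = r + 1 + (r + 1) := by
    simp only [Fintype.card_sum, Fintype.card_prod, Fintype.card_bool, Fintype.card_fin]
    ring
  refine ⟨Fintype.card (ZMod 2 × ZMod 2 × ZMod p), by omega, ?_⟩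
  rw [← hdeg]
  have htwo : ∀ a : ZMod 2, a = 0 ∨ a = 1 := by decide
  let σ : ℝ → ZMod 2 → ℝ := fun t a => if a = 0 then 1 else t
  have hσ1 : ∀ t, t ^ 2 = 1 → ∀ a, σ t (a + 1) = t * σ t a := by
    intro t ht a
    have h11 : (1 : ZMod 2) + 1 = 0 := by decide
    rcases htwo a with rfl | rfl
    · simp [σ]
    · simp [σ, h11, ← sq, ht]
  have hσ : ∀ t, t ^ 2 = 1 → ∀ (k : ℕ) a, σ t (a + k) = t ^ k * σ t a := by
    intro t ht k a
    induction k with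
    | zero => simp
    | succ k ih => rw [Nat.cast_succ, ← add_assoc, hσ1 t ht, ih, pow_succ']; ring
  have hneg : (-1 : ℝ) ^ 2 = 1 := by norm_num
  refine exists_cayley_nut_graph (nutConnection p r) (nutConnection_injective (by omega))
    (nutConnection_ne_zero (by omega)) (nutConnection_neg p r)
    (fun u => σ (-1) u.1 * σ s u.2.1) ?_ ?_ ?_
  · rintro ⟨a, b, j⟩
    simp only [σ]
    split_ifs <;> simp [hs0]
  · rintro ⟨a, b, j⟩
    rw [sum_nutConnection p r (fun u => σ (-1) u.1 * σ s u.2.1)]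
    simp only [hσ _ hneg, hσ1 _ hneg, hσ1 _ hs]
    have : ∀ k ∈ Finset.range r, (-1) ^ k * σ (-1) a * σ s b + (-1) ^ k * σ (-1) a * σ s b =
        (-1) ^ k * (2 * (σ (-1) a * σ s b)) := fun k _ => by ring
    rw [Finset.sum_congr rfl this, ← Finset.sum_mul]
    linear_combination σ (-1) a * σ s b * hsum
  · intro x hx
    have key := fun e f he hf => signed_sum_eq hp hr (by omega) x hx e f he hf _ fun _ => rfl
    obtain ⟨hc1, hv1⟩ := key 1 1 (by norm_num) (by norm_num)
    obtain ⟨hc2, hv2⟩ := key 1 (-1) (by norm_num) (by norm_num)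
    obtain ⟨hc3, hv3⟩ := key (-1) (-(-1) ^ r) (by norm_num) (by rw [neg_sq, hsQ])
    obtain ⟨hc4, -⟩ := key (-1) ((-1) ^ r) (by norm_num) hsQ
    have hrpos : (0 : ℝ) < r := by exact_mod_cast hr
    push_cast at hc1 hc2 hc3 hc4 hv1 hv2 hv3
    rw [← hs_def] at hc3 hc4 hv3
    rw [hsum] at hv3
    simp only [one_pow, Finset.sum_const, Finset.card_range, nsmul_eq_mul] at hv1 hv2
    replace hv1 := (mul_eq_zero.1 hv1).resolve_left (by positivity)
    replace hv2 := (mul_eq_zero.1 hv2).resolve_left (by ring_nf; positivity)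
    replace hv3 := (mul_eq_zero.1 hv3).resolve_left (by
      intro h
      apply hs0
      linear_combination (-1 / 2) * h)
    refine ⟨(x (0, 0, 0) - x (1, 0, 0) + s * x (0, 1, 0) - s * x (1, 1, 0)) / 4, ?_⟩
    ext ⟨a, b, j⟩
    have h1 := (hc1 j).trans hv1
    have h2 := (hc2 j).trans hv2
    have h3 := (hc3 j).trans hv3
    have h4 := hc4 j
    rcases htwo a with rfl | rfl <;> rcases htwo b with rfl | rfl <;> simp [σ]
    · linear_combination (h1 + h2 + h3 + h4) / 4
    · linear_combination (h1 - h2 - s * h3 + s * h4) / 4 - (x (0, 1, j) - x (1, 1, j)) / 2 * hs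
    · linear_combination (h1 + h2 - h3 - h4) / 4
    · linear_combination (h1 - h2 + s * h3 - s * h4) / 4 + (x (0, 1, j) - x (1, 1, j)) / 2 * hs
end

section
/- Let G₁ and G₂ be nut graphs. Then the cartesian product G₁ □ G₂ is a nut graph if and only if there does not exist a real number λ ≠ 0 such that λ is an eigenvalue of the adjacency matrix of G₁ and −λ is an eigenvalue of the adjacency matrix of G₂. -/
open SimpleGraph Matrix Module

theorem isNutGraph_iff_exists {V : Type*} [Fintype V] (G : SimpleGraph V) :
    IsNutGraph G ↔ ∃ u : V → ℝ, u ≠ 0 ∧ (adjMatR G).mulVec u = 0 ∧ (∀ v, u v ≠ 0) ∧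
      ∀ x : V → ℝ, (adjMatR G).mulVec x = 0 → ∃ c : ℝ, c • u = x := by
  constructor
  · rintro ⟨hdim, hne⟩
    obtain ⟨⟨u, hu⟩, hu0, hspan⟩ := finrank_eq_one_iff'.1 hdim
    have hu' : (adjMatR G).mulVec u = 0 := by simpa using hu
    have hu0' : u ≠ 0 := by simpa using hu0
    refine ⟨u, hu0', hu', hne u hu' hu0', fun x hx => ?_⟩
    obtain ⟨c, hc⟩ := hspan ⟨x, by simpa using hx⟩
    exact ⟨c, by simpa using hc⟩
  · rintro ⟨u, hu0, hu, hne, hspan⟩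
    refine ⟨finrank_eq_one_iff'.2 ⟨⟨u, by simpa using hu⟩, by simpa using hu0, ?_⟩, ?_⟩
    · rintro ⟨x, hx⟩
      obtain ⟨c, hc⟩ := hspan x (by simpa using hx)
      exact ⟨c, by simpa using hc⟩
    · intro x hx hx0 v
      obtain ⟨c, rfl⟩ := hspan x hx
      have hc : c ≠ 0 := by
        rintro rfl
        simp at hx0
      exact mul_ne_zero hc (hne v)

theorem adjMatR_isSymm {V : Type*} [Fintype V] (G : SimpleGraph V) : (adjMatR G).IsSymm := by
  ext i j
  by_cases h : G.Adj i j
  · simp [adjMatR, h, h.symm]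
  · simp [adjMatR, h, mt SimpleGraph.Adj.symm h]

theorem adjMatR_boxProd_mulVec {V₁ V₂ : Type*} [Fintype V₁] [Fintype V₂]
    (G₁ : SimpleGraph V₁) (G₂ : SimpleGraph V₂) (x : V₁ × V₂ → ℝ) (p : V₁ × V₂) :
    (adjMatR (G₁ □ G₂)).mulVec x p =
      (adjMatR G₁).mulVec (fun i => x (i, p.2)) p.1 +
        (adjMatR G₂).mulVec (fun j => x (p.1, j)) p.2 := by
  classical
  have key : ∀ q : V₁ × V₂, adjMatR (G₁ □ G₂) p q =
      (if p.2 = q.2 then adjMatR G₁ p.1 q.1 else 0) +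
        (if p.1 = q.1 then adjMatR G₂ p.2 q.2 else 0) := by
    rintro ⟨i, j⟩
    obtain ⟨a, b⟩ := p
    by_cases hj : b = j <;> by_cases hi : a = i <;> simp [adjMatR, boxProd_adj, hi, hj]
  simp only [mulVec, dotProduct, key, add_mul, Finset.sum_add_distrib, ite_mul, zero_mul]
  congr 1
  · simp [Fintype.sum_prod_type]
  · simp [Fintype.sum_prod_type_right]

/-- If `A * X + X * B = 0` with `B` symmetric and no nonzero eigenvalue of `A` is the negative of
an eigenvalue of `B`, then `A * X = 0`. -/
theorem mul_eq_zero_of_add_eq_zero_of_isSymm {m n : Type*} [Fintype m] [Fintype n]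
    {A : Matrix m m ℝ} {B : Matrix n n ℝ} (hB : B.IsSymm)
    (h : ¬ ∃ lam : ℝ, lam ≠ 0 ∧ Module.End.HasEigenvalue A.mulVecLin lam ∧
      Module.End.HasEigenvalue B.mulVecLin (-lam))
    {X : Matrix m n ℝ} (hX : A * X + X * B = 0) : A * X = 0 := by
  classical
  have hH : B.IsHermitian := by
    rw [Matrix.IsHermitian, conjTranspose_eq_transpose_of_trivial]
    exact hB
  have hbasis : ∀ j, (A * X) *ᵥ (hH.eigenvectorBasis j).ofLp = 0 := by
    intro j
    set w : n → ℝ := (hH.eigenvectorBasis j).ofLp with hw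
    have hw0 : w ≠ 0 := by
      intro h0
      exact hH.eigenvectorBasis.orthonormal.ne_zero j ((WithLp.ofLp_eq_zero 2).1 h0)
    have hBw : B *ᵥ w = hH.eigenvalues j • w := hH.mulVec_eigenvectorBasis j
    have hAX : A *ᵥ (X *ᵥ w) = (-hH.eigenvalues j) • (X *ᵥ w) := by
      have := congrArg (· *ᵥ w) hX
      simp only [add_mulVec, zero_mulVec, ← mulVec_mulVec, hBw, mulVec_smul] at this
      rw [neg_smul]
      exact eq_neg_of_add_eq_zero_left this
    rw [← mulVec_mulVec]
    by_cases hmu : hH.eigenvalues j = 0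
    · rw [hAX, hmu, neg_zero, zero_smul]
    · by_cases hXw : X *ᵥ w = 0
      · rw [hXw, mulVec_zero]
      · refine absurd ⟨-hH.eigenvalues j, neg_ne_zero.2 hmu, ?_, ?_⟩ h
        · exact Module.End.hasEigenvalue_of_hasEigenvector
            ⟨Module.End.mem_eigenspace_iff.2 hAX, hXw⟩
        · rw [neg_neg]
          exact Module.End.hasEigenvalue_of_hasEigenvector
            ⟨Module.End.mem_eigenspace_iff.2 hBw, hw0⟩
  have hlin : (A * X).mulVecLin ∘ₗ (WithLp.linearEquiv 2 ℝ (n → ℝ)).toLinearMap = 0 :=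
    hH.eigenvectorBasis.toBasis.ext fun j => by simpa using hbasis j
  apply Matrix.ext_of_mulVec_single
  intro i
  rw [zero_mulVec]
  exact LinearMap.congr_fun hlin (WithLp.toLp 2 (Pi.single i 1))

theorem adjMatR_boxProd_mulVec_tensor {V₁ V₂ : Type*} [Fintype V₁] [Fintype V₂]
    (G₁ : SimpleGraph V₁) (G₂ : SimpleGraph V₂) {y : V₁ → ℝ} {z : V₂ → ℝ} {lam : ℝ}
    (hy : (adjMatR G₁).mulVec y = lam • y) (hz : (adjMatR G₂).mulVec z = (-lam) • z) :
    (adjMatR (G₁ □ G₂)).mulVec (fun p => y p.1 * z p.2) = 0 := by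
  ext p
  have e₁ : (fun i => y i * z p.2) = z p.2 • y := by
    ext i
    simp [mul_comm]
  have e₂ : (fun j => y p.1 * z j) = y p.1 • z := rfl
  rw [adjMatR_boxProd_mulVec]
  simp only [e₁, e₂, mulVec_smul, hy, hz, Pi.smul_apply, smul_eq_mul, Pi.zero_apply]
  ring

theorem adjMatR_boxProd_mulVec_eq_zero_iff {V₁ V₂ : Type*} [Fintype V₁] [Fintype V₂]
    (G₁ : SimpleGraph V₁) (G₂ : SimpleGraph V₂) (x : V₁ × V₂ → ℝ) :
    (adjMatR (G₁ □ G₂)).mulVec x = 0 ↔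
      adjMatR G₁ * Matrix.of (fun i j => x (i, j)) +
        Matrix.of (fun i j => x (i, j)) * adjMatR G₂ = 0 := by
  rw [← Matrix.ext_iff, funext_iff, Prod.forall]
  refine forall_congr' fun i => forall_congr' fun j => ?_
  rw [adjMatR_boxProd_mulVec]
  simp only [mulVec, dotProduct, Matrix.add_apply, Matrix.mul_apply, Matrix.of_apply,
    Matrix.zero_apply, Pi.zero_apply]
  simp only [fun k => (adjMatR_isSymm G₂).apply j k, mul_comm (adjMatR G₂ j _)]

/-- Let `G₁` and `G₂` be nut graphs. Then `G₁ □ G₂` is a nut graph if and only if there is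
no `λ ≠ 0` that is an eigenvalue of `G₁` such that `-λ` is an eigenvalue of `G₂`. -/
theorem boxProd_nut_iff {V₁ V₂ : Type*} [Fintype V₁] [Fintype V₂]
    (G₁ : SimpleGraph V₁) (G₂ : SimpleGraph V₂)
    (h₁ : IsNutGraph G₁) (h₂ : IsNutGraph G₂) :
    IsNutGraph (G₁ □ G₂) ↔
      ¬ ∃ lam : ℝ, lam ≠ 0 ∧ Module.End.HasEigenvalue (adjMatR G₁).mulVecLin lam ∧
        Module.End.HasEigenvalue (adjMatR G₂).mulVecLin (-lam) := by
  obtain ⟨u, hu0, hu, hune, huspan⟩ := (isNutGraph_iff_exists G₁).1 h₁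
  obtain ⟨v, hv0, hv, hvne, hvspan⟩ := (isNutGraph_iff_exists G₂).1 h₂
  obtain ⟨i₀, -⟩ := Function.ne_iff.1 hu0
  obtain ⟨j₀, -⟩ := Function.ne_iff.1 hv0
  have huv : (adjMatR (G₁ □ G₂)).mulVec (fun p => u p.1 * v p.2) = 0 :=
    adjMatR_boxProd_mulVec_tensor G₁ G₂ (lam := 0) (by simpa using hu) (by simpa using hv)
  constructor
  · rintro hnut ⟨lam, hlam, hlam₁, hlam₂⟩
    obtain ⟨y, hy⟩ := hlam₁.exists_hasEigenvector
    obtain ⟨z, hz⟩ := hlam₂.exists_hasEigenvector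
    have hAy : (adjMatR G₁).mulVec y = lam • y := hy.apply_eq_smul
    have hBz : (adjMatR G₂).mulVec z = (-lam) • z := hz.apply_eq_smul
    obtain ⟨j, hj⟩ := Function.ne_iff.1 hz.2
    obtain ⟨w, hw0, -, hwne, hwspan⟩ := (isNutGraph_iff_exists _).1 hnut
    obtain ⟨c, hc⟩ := hwspan _ huv
    obtain ⟨d, hd⟩ := hwspan _ (adjMatR_boxProd_mulVec_tensor G₁ G₂ hAy hBz)
    have hc0 : c ≠ 0 := by
      rintro rfl
      have := congrFun hc (i₀, j₀)
      simp [hune, hvne] at this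
    have hyu : y = (d * v j / (c * z j)) • u := by
      ext i
      have e₁ : c * w (i, j) = u i * v j := congrFun hc (i, j)
      have e₂ : d * w (i, j) = y i * z j := congrFun hd (i, j)
      have hj' : z j ≠ 0 := hj
      simp only [Pi.smul_apply, smul_eq_mul]
      field_simp
      linear_combination d * e₁ - c * e₂
    have hAy0 : lam • y = 0 := by
      rw [← hAy, hyu, mulVec_smul, hu, smul_zero]
    exact (smul_ne_zero hlam hy.2) hAy0
  · intro h
    refine (isNutGraph_iff_exists _).2 ⟨fun p => u p.1 * v p.2, ?_, huv,
      fun p => mul_ne_zero (hune _) (hvne _), fun x hx => ?_⟩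
    · exact Function.ne_iff.2 ⟨(i₀, j₀), mul_ne_zero (hune _) (hvne _)⟩
    · rw [adjMatR_boxProd_mulVec_eq_zero_iff] at hx
      have hAX := mul_eq_zero_of_add_eq_zero_of_isSymm (adjMatR_isSymm G₂) h hx
      have hXB := hx
      rw [hAX, zero_add] at hXB
      have hcol : ∀ j, ∃ c : ℝ, c • u = fun i => x (i, j) := fun j =>
        huspan _ (funext fun i => congrFun (congrFun hAX i) j)
      have hrow : ∀ i, ∃ c : ℝ, c • v = fun j => x (i, j) := fun i =>
        hvspan _ (by
          rw [← (adjMatR_isSymm G₂).eq, mulVec_transpose]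
          exact funext fun j => congrFun (congrFun hXB i) j)
      choose r hr using hcol
      obtain ⟨c, hc⟩ := hrow i₀
      refine ⟨c / u i₀, funext fun ⟨i, j⟩ => ?_⟩
      have e₁ : r j * u i = x (i, j) := congrFun (hr j) i
      have e₂ : r j * u i₀ = x (i₀, j) := congrFun (hr j) i₀
      have e₃ : c * v j = x (i₀, j) := congrFun hc j
      have hi₀ := hune i₀
      simp only [Pi.smul_apply, smul_eq_mul]
      field_simp
      rw [← e₁]
      linear_combination u i * (e₃ - e₂)
end

section
/- Let ψ ∈ ℂ be a root of unity whose (multiplicative) order b satisfies b ≥ 3 and b ≢ 0 (mod 4). Then for every positive integer t, ψ is not a root of the polynomial 2x^{4t+3} + x^{2t+8} − x^{2t} − 2x^5, and ψ is not a root of the polynomial 2x^{4t+3} − x^{2t+8} + x^{2t} − 2x^5. -/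
open SimpleGraph Matrix Module

/-- Half of an odd natural number is not an algebraic integer. -/
theorem not_isIntegral_odd_div_two {m : ℕ} (hm : Odd m) : ¬ IsIntegral ℤ ((m : ℂ) / 2) := by
  intro h
  have hq : IsIntegral ℤ ((m : ℚ) / 2) := by
    rw [← isIntegral_algebraMap_iff (algebraMap ℚ ℂ).injective]
    simpa using h
  obtain ⟨k, hk⟩ := IsIntegrallyClosed.isIntegral_iff.mp hq
  have hk' : (m : ℚ) = 2 * k := by
    rw [eq_intCast] at hk
    linarith
  have hk'' : (m : ℤ) = 2 * k := by exact_mod_cast hk'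
  obtain ⟨r, rfl⟩ := hm
  omega

/-- If `w ≠ 1` is a root of unity of odd order, then `2` does not divide `w - 1` in the ring of
algebraic integers. -/
theorem not_isIntegral_of_two_mul_eq_sub_one {w y : ℂ} {m : ℕ} (hm : Odd m) (hw : w ^ m = 1)
    (hw1 : w ≠ 1) (hy : 2 * y = w - 1) : ¬ IsIntegral ℤ y := by
  intro hyi
  have hwi : IsIntegral ℤ w := IsIntegral.of_pow hm.pos (hw ▸ isIntegral_one)
  have hsum : ∑ i ∈ Finset.range m, w ^ i = 0 := by
    have h := geom_sum_mul w m
    rw [hw, sub_self] at h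
    exact (mul_eq_zero.mp h).resolve_right (sub_ne_zero.mpr hw1)
  have hterm (i : ℕ) : w ^ i = 1 + 2 * (y * ∑ j ∈ Finset.range i, w ^ j) := by
    linear_combination -geom_sum_mul w i - (∑ j ∈ Finset.range i, w ^ j) * hy
  have hz : (m : ℂ) / 2 = -∑ i ∈ Finset.range m, y * ∑ j ∈ Finset.range i, w ^ j := by
    rw [Finset.sum_congr rfl fun i _ => hterm i, Finset.sum_add_distrib, ← Finset.mul_sum] at hsum
    simp only [Finset.sum_const, Finset.card_range, nsmul_eq_mul, mul_one] at hsum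
    linear_combination hsum / 2
  refine not_isIntegral_odd_div_two hm (hz ▸ ?_)
  exact (IsIntegral.sum _ fun i _ => hyi.mul (IsIntegral.sum _ fun j _ => hwi.pow j)).neg

/-- If `ψ` is a root of unity of order `b` with `b ≥ 3` and `b ≢ 0 (mod 4)`, then `ψ` is not
a root of `2x^{4t+3} + x^{2t+8} - x^{2t} - 2x^5` nor of `2x^{4t+3} - x^{2t+8} + x^{2t} - 2x^5`
for any positive integer `t`. -/
theorem caux_lemma (ψ : ℂ) (b : ℕ) (hprim : IsPrimitiveRoot ψ b)
    (hb3 : 3 ≤ b) (hb4 : ¬ (4 ∣ b)) (t : ℕ) (ht : 1 ≤ t) :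
    2 * ψ ^ (4 * t + 3) + ψ ^ (2 * t + 8) - ψ ^ (2 * t) - 2 * ψ ^ 5 ≠ 0 ∧
    2 * ψ ^ (4 * t + 3) - ψ ^ (2 * t + 8) + ψ ^ (2 * t) - 2 * ψ ^ 5 ≠ 0 := by
  obtain ⟨m, hm, hbm⟩ : ∃ m, Odd m ∧ b ∣ 2 * m := by
    rcases Nat.even_or_odd b with ⟨k, hk⟩ | hb
    · exact ⟨k, by rw [← Nat.not_even_iff_odd]; rintro ⟨r, hr⟩; omega, ⟨1, by omega⟩⟩
    · exact ⟨b, hb, ⟨2, by ring⟩⟩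
  have hw : (ψ ^ 8) ^ m = 1 := by
    rw [← pow_mul, hprim.pow_eq_one_iff_dvd]
    exact hbm.trans ⟨4, by ring⟩
  have hw1 : ψ ^ 8 ≠ 1 := by
    rw [Ne, hprim.pow_eq_one_iff_dvd]
    intro h
    have : b ≤ 8 := Nat.le_of_dvd (by norm_num) h
    interval_cases b <;> omega
  have hψ0 : ψ ≠ 0 := hprim.ne_zero (by omega)
  have hψ : IsIntegral ℤ ψ := hprim.isIntegral (by omega)
  have hψinv : IsIntegral ℤ ψ⁻¹ := hprim.inv.isIntegral (by omega)
  have hinv : ψ ^ (2 * t) * ψ⁻¹ ^ (2 * t) = 1 := by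
    rw [← mul_pow, mul_inv_cancel₀ hψ0, one_pow]
  have hy : IsIntegral ℤ ((ψ ^ 5 - ψ ^ (4 * t + 3)) * ψ⁻¹ ^ (2 * t)) :=
    ((hψ.pow _).sub (hψ.pow _)).mul (hψinv.pow _)
  constructor <;> intro h
  · refine not_isIntegral_of_two_mul_eq_sub_one hm hw hw1 ?_ hy
    rw [pow_add ψ (2 * t) 8] at h
    linear_combination (ψ ^ 8 - 1) * hinv - ψ⁻¹ ^ (2 * t) * h
  · refine not_isIntegral_of_two_mul_eq_sub_one hm hw hw1 ?_ hy.neg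
    rw [pow_add ψ (2 * t) 8] at h
    linear_combination (ψ ^ 8 - 1) * hinv + ψ⁻¹ ^ (2 * t) * h
end

section
/- Let t be a positive integer and let m ≥ 4t + 6 satisfy m ≡ 2 (mod 4). Set S = {1, 2, …, t−1} ∪ {(m+2)/4, (m+6)/4} ∪ {m/2 − (t−1), …, m/2 − 2, m/2 − 1} ∪ {m/2}. Then the graph Circ(m, S) □ K₂ is a (4t + 2)-regular nut graph of order 2m, and it is a Cayley graph of the group ℤ_m × ℤ₂. -/
open SimpleGraph Matrix Module

open Classical in
lemma sum_Circ_adj {n h : ℕ} [NeZero n] (hn : 2 * h = n) {S : Finset ℕ}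
    (hS : ∀ s ∈ S, 0 < s ∧ s < h) {M : Type*} [AddCommMonoid M] (g : ZMod n → M) (u : ZMod n) :
    ∑ v, (if (Circ n (S ∪ {h})).Adj u v then g v else 0) =
      ∑ s ∈ S, (g (u + s) + g (u - s)) + g (u + h) := by
  have hn0 : n ≠ 0 := NeZero.ne n
  have hcast {a : ℕ} (ha : 0 < a) (ha' : a < n) : (a : ZMod n) ≠ 0 := by
    rw [Ne, ZMod.natCast_eq_zero_iff]
    exact Nat.not_dvd_of_pos_of_lt ha ha'
  have hinj {a b : ℕ} (ha : a < n) (hb : b < n) (hab : (a : ZMod n) = b) : a = b := by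
    rwa [ZMod.natCast_eq_natCast_iff', Nat.mod_eq_of_lt ha, Nat.mod_eq_of_lt hb] at hab
  have hhh : (h : ZMod n) + h = 0 := by
    rw [← two_mul]; exact_mod_cast (ZMod.natCast_eq_zero_iff (2 * h) n).mpr hn.symm.dvd
  have hadj (v : ZMod n) : (Circ n (S ∪ {h})).Adj u v ↔
      v ∈ (S.image fun s : ℕ => u + (s : ZMod n)) ∪ (S.image fun s : ℕ => u - (s : ZMod n)) ∪
        {u + (h : ZMod n)} := by
    simp only [Circ, circulantGraph, fromRel_adj, Set.mem_image, Finset.mem_coe, Finset.mem_union,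
      Finset.mem_singleton, Finset.mem_image]
    constructor
    · rintro ⟨-, ⟨s, hs | rfl, e⟩ | ⟨s, hs | rfl, e⟩⟩
      · exact .inl (.inr ⟨s, hs, by rw [e]; abel⟩)
      · exact .inr (by rw [eq_neg_of_add_eq_zero_left hhh, e]; abel)
      · exact .inl (.inl ⟨s, hs, by rw [e]; abel⟩)
      · exact .inr (by rw [e]; abel)
    · rintro ((⟨s, hs, rfl⟩ | ⟨s, hs, rfl⟩) | rfl)
      · have := hS s hs
        exact ⟨by simpa using hcast this.1 (by omega), .inr ⟨s, .inl hs, by abel⟩⟩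
      · have := hS s hs
        exact ⟨fun e => hcast this.1 (by omega) (by linear_combination e), .inl ⟨s, .inl hs, by abel⟩⟩
      · exact ⟨by simpa using hcast (a := h) (by omega) (by omega), .inr ⟨h, .inr rfl, by abel⟩⟩
  simp only [hadj]
  rw [Finset.sum_ite_mem, Finset.univ_inter, Finset.sum_union, Finset.sum_union,
    Finset.sum_image, Finset.sum_image, Finset.sum_singleton, Finset.sum_add_distrib]
  · intro a ha b hb hab
    have := hS a ha
    have := hS b hb
    exact hinj (by omega) (by omega) (by simpa using hab)
  · intro a ha b hb hab
    have := hS a ha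
    have := hS b hb
    exact hinj (by omega) (by omega) (by simpa using hab)
  · rw [Finset.disjoint_left]
    intro x hx hx'
    obtain ⟨a, ha, rfl⟩ := Finset.mem_image.mp hx
    obtain ⟨b, hb, e⟩ := Finset.mem_image.mp hx'
    have := hS a ha
    have := hS b hb
    refine hcast (a := a + b) (by omega) (by omega) ?_
    push_cast
    linear_combination -e
  · rw [Finset.disjoint_singleton_right, Finset.mem_union, Finset.mem_image, Finset.mem_image]
    rintro (⟨a, ha, e⟩ | ⟨a, ha, e⟩)
    · have := hS a ha
      have := hinj (a := a) (b := h) (by omega) (by omega) (by simpa using e)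
      omega
    · have := hS a ha
      refine hcast (a := a + h) (by omega) (by omega) ?_
      push_cast
      linear_combination -e

/-- The elements of the connection set below `m / 2`, where `m = 4 k + 2`. -/
abbrev smallJumps (t k : ℕ) : Finset ℕ :=
  Finset.Icc 1 (t - 1) ∪ {k + 1, k + 2} ∪ Finset.Icc (2 * k + 1 - (t - 1)) (2 * k + 1 - 1)

lemma smallJumps_bounds {t k : ℕ} (ht : 1 ≤ t) (hk : t + 1 ≤ k) :
    ∀ s ∈ smallJumps t k, 0 < s ∧ s < 2 * k + 1 := by
  intro s hs
  simp only [smallJumps, Finset.mem_union, Finset.mem_Icc, Finset.mem_insert,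
    Finset.mem_singleton] at hs
  omega

lemma sum_smallJumps {t k : ℕ} (hk : t + 1 ≤ k) {M : Type*} [AddCommMonoid M] (F : ℕ → M) :
    ∑ s ∈ smallJumps t k, F s =
      ∑ s ∈ Finset.Icc 1 (t - 1), (F s + F (2 * k + 1 - s)) + F (k + 1) + F (k + 2) := by
  rw [smallJumps, Finset.sum_union, Finset.sum_union, Finset.sum_pair (by omega),
    Finset.sum_add_distrib]
  · have : ∑ s ∈ Finset.Icc (2 * k + 1 - (t - 1)) (2 * k + 1 - 1), F s =
        ∑ s ∈ Finset.Icc 1 (t - 1), F (2 * k + 1 - s) := by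
      refine Finset.sum_nbij' (2 * k + 1 - ·) (2 * k + 1 - ·) ?_ ?_ ?_ ?_ ?_ <;>
        simp only [Finset.mem_Icc] <;> intro s hs
      · omega
      · omega
      · omega
      · omega
      · congr 1; omega
    rw [this]
    abel
  · rw [Finset.disjoint_left]
    simp only [Finset.mem_Icc, Finset.mem_insert, Finset.mem_singleton]
    omega
  · rw [Finset.disjoint_left]
    simp only [Finset.mem_union, Finset.mem_Icc, Finset.mem_insert, Finset.mem_singleton]
    intro s hs hs'
    omega

/-- The number `1 / 2` is not an algebraic integer. -/
lemma two_mul_ne_one_of_isIntegral {u : ℂ} (hu : IsIntegral ℤ u) : 2 * u ≠ 1 := by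
  intro h
  have h2 : u = algebraMap ℚ ℂ (1 / 2) := by
    simp only [map_div₀, map_one, map_ofNat]
    linear_combination h / 2
  rw [h2, isIntegral_algebraMap_iff (algebraMap ℚ ℂ).injective,
    IsIntegrallyClosed.isIntegral_iff] at hu
  obtain ⟨y, hy⟩ := hu
  have : (2 * y : ℚ) = 1 := by
    have : (y : ℚ) = 1 / 2 := by simpa using hy
    rw [this]; norm_num
  have : 2 * y = 1 := by exact_mod_cast this
  omega

/-- The eigenvalue of the circulant graph at an `m`-th root of unity `z`, where `m = 4 k + 2`. -/
def circEigenvalue {K : Type*} [Field K] (t k : ℕ) (z : K) : K :=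
  ∑ s ∈ Finset.Icc 1 (t - 1), (z ^ s + z⁻¹ ^ s) * (1 + z ^ (2 * k + 1)) +
    (z ^ (k + 1) + z⁻¹ ^ (k + 1)) + (z ^ (k + 2) + z⁻¹ ^ (k + 2)) + z ^ (2 * k + 1)

lemma sq_eq_one_of_circEigenvalue {t k : ℕ} {z : ℂ} (hz : z ^ (4 * k + 2) = 1) {e : ℤ}
    (he : e = 1 ∨ e = -1) (h : circEigenvalue t k z + e = 0) : z ^ (2 * k + 1) = z := by
  have hz0 : z ≠ 0 := by rintro rfl; simp at hz
  obtain ⟨σ, hσ, hσz⟩ : ∃ σ : ℤ, (σ = 1 ∨ σ = -1) ∧ z ^ (2 * k + 1) = σ := by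
    have : (z ^ (2 * k + 1)) ^ 2 = 1 := by rw [← pow_mul, ← hz]; ring_nf
    rcases mul_self_eq_one_iff.mp (by rwa [sq] at this) with h | h
    · exact ⟨1, by simp, by simpa using h⟩
    · exact ⟨-1, by simp, by simpa using h⟩
  have hσ2 : (σ : ℂ) * σ = 1 := by rcases hσ with rfl | rfl <;> norm_num
  have hzi : IsIntegral ℤ z := IsIntegral.of_pow (n := 4 * k + 2) (by omega) (hz ▸ isIntegral_one)
  have hzi' : IsIntegral ℤ z⁻¹ :=
    IsIntegral.of_pow (n := 4 * k + 2) (by omega) (by rw [inv_pow, hz, inv_one]; exact isIntegral_one)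
  have hint (n : ℤ) : IsIntegral ℤ (n : ℂ) := isIntegral_algebraMap (R := ℤ) (x := n)
  by_contra hne
  set w : ℂ := σ * z with hw
  have hw1 : w ≠ 1 := fun h1 => hne (by rw [hσz]; linear_combination z * hσ2 - σ * h1)
  have hwi : IsIntegral ℤ w := (hint σ).mul hzi
  have hwh : w ^ (2 * k + 1) = 1 := by
    rw [hw, mul_pow, hσz, pow_succ, pow_mul, sq, hσ2, one_pow, one_mul, hσ2]
  set y := z ^ (k + 1) with hy
  have hy0 : y ≠ 0 := pow_ne_zero _ hz0
  have hy2 : y ^ 2 = w := by rw [hw, ← hσz, hy]; ring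
  have hyi : IsIntegral ℤ y := hzi.pow _
  have hyi' : IsIntegral ℤ y⁻¹ := by rw [hy, ← inv_pow]; exact hzi'.pow _
  set U := y * ∑ i ∈ Finset.range (k + 1), (w ^ 2) ^ i with hU
  have hUi : IsIntegral ℤ U := hyi.mul (IsIntegral.sum _ fun i _ => (hwi.pow _).pow _)
  have hxU : (y + y⁻¹) * U = 1 := by
    have hg := geom_sum_mul (w ^ 2) (k + 1)
    have h1 : (w ^ 2) ^ (k + 1) = w := by
      rw [← pow_mul, show 2 * (k + 1) = 2 * k + 1 + 1 by ring, pow_succ, hwh, one_mul]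
    have h2 : (y + y⁻¹) * y = w + 1 := by field_simp; rw [hy2]
    rw [h1] at hg
    rw [hU, ← mul_assoc, h2]
    apply mul_right_cancel₀ (sub_ne_zero.mpr hw1)
    linear_combination hg
  have hz2 : z ^ (k + 2) = σ * y ^ 3 := by
    rw [show y ^ 3 = y ^ 2 * y by ring, hy2, hw, hy]; linear_combination (-z ^ (k + 2)) * hσ2
  set E := ∑ s ∈ Finset.Icc 1 (t - 1), (z ^ s + z⁻¹ ^ s) with hE
  have hEi : IsIntegral ℤ E := IsIntegral.sum _ fun i _ => (hzi.pow _).add (hzi'.pow _)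
  have hσinv : (σ : ℂ)⁻¹ = σ := inv_eq_of_mul_eq_one_left hσ2
  rw [circEigenvalue, ← Finset.sum_mul, inv_pow, inv_pow, hz2, hσz, mul_inv, hσinv, ← hE, ← hy] at h
  obtain ⟨a, ha⟩ : ∃ a : ℤ, 1 + σ = 2 * a := ⟨(1 + σ) / 2, by omega⟩
  obtain ⟨b, hb⟩ : ∃ b : ℤ, σ + e = 2 * b := ⟨(σ + e) / 2, by omega⟩
  obtain ⟨c, hc⟩ : ∃ c : ℤ, 1 - 3 * σ = 2 * c := ⟨(1 - 3 * σ) / 2, by omega⟩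
  have ha' : (1 + σ : ℂ) = 2 * a := by exact_mod_cast ha
  have hb' : (σ + e : ℂ) = 2 * b := by exact_mod_cast hb
  have hc' : (1 - 3 * σ : ℂ) = 2 * c := by exact_mod_cast hc
  have hyy : y * y⁻¹ = 1 := mul_inv_cancel₀ hy0
  have key : σ * (y + y⁻¹) ^ 3 = -2 * (a * E + c * (y + y⁻¹) + b) := by
    rw [← inv_pow] at h
    linear_combination h - E * ha' - hb' - (y + y⁻¹) * hc' + 3 * σ * (y + y⁻¹) * hyy
  refine two_mul_ne_one_of_isIntegral (u := -σ * (a * E + c * (y + y⁻¹) + b) * U ^ 3)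
    (((hint σ).neg.mul ((((hint a).mul hEi).add ((hint c).mul (hyi.add hyi'))).add (hint b))).mul
      (hUi.pow _)) ?_
  have h3 : (y + y⁻¹) ^ 3 * U ^ 3 = 1 := by rw [← mul_pow, hxU, one_pow]
  linear_combination (-σ * U ^ 3) * key + h3 * (σ * σ) + hσ2

lemma eq_of_circEigenvalue {t k : ℕ} (ht : 1 ≤ t) {z : ℂ} (hz : z ^ (4 * k + 2) = 1) {e : ℤ}
    (he : e = 1 ∨ e = -1) (h : circEigenvalue t k z + e = 0) : z = -1 ∧ e = 1 := by
  have hz0 : z ≠ 0 := by rintro rfl; simp at hz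
  have hzz := sq_eq_one_of_circEigenvalue hz he h
  have hz2 : z ^ 2 = 1 := by rw [← hz, ← congrArg (· ^ 2) hzz, ← pow_mul]; ring_nf
  rcases mul_self_eq_one_iff.mp (by rwa [sq] at hz2) with rfl | rfl
  · exfalso
    have : ((4 * t + 1 + e : ℤ) : ℂ) = 0 := by
      rw [← h]
      simp [circEigenvalue, Nat.cast_sub ht]
      ring
    have : 4 * (t : ℤ) + 1 + e = 0 := by exact_mod_cast this
    omega
  · refine ⟨rfl, ?_⟩
    have : (e : ℂ) = 1 := by
      rw [circEigenvalue, hzz] at h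
      simp [pow_succ] at h
      linear_combination h
    exact_mod_cast this

open Classical in
lemma sum_circ_addChar {t k : ℕ} (ht : 1 ≤ t) (hk : t + 1 ≤ k) [NeZero (4 * k + 2)]
    {K : Type*} [Field K]
    (ψ : AddChar (ZMod (4 * k + 2)) K) (u : ZMod (4 * k + 2)) :
    ∑ v, (if (Circ (4 * k + 2) (smallJumps t k ∪ {2 * k + 1})).Adj u v then ψ v else 0) =
      circEigenvalue t k (ψ 1) * ψ u := by
  have hpow (s : ℕ) : ψ (s : ZMod (4 * k + 2)) = ψ 1 ^ s := by
    rw [← nsmul_one, AddChar.map_nsmul_eq_pow]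
  have hz : ψ 1 ^ (4 * k + 2) = 1 := by rw [← hpow, ZMod.natCast_self, AddChar.map_zero_eq_one]
  have hz0 : ψ 1 ≠ 0 := by rintro h; simp [h] at hz
  have hadd (s : ℕ) : ψ (u + s) = ψ u * ψ 1 ^ s := by rw [AddChar.map_add_eq_mul, hpow]
  have hsub (s : ℕ) : ψ (u - s) = ψ u * (ψ 1)⁻¹ ^ s := by
    rw [sub_eq_add_neg, AddChar.map_add_eq_mul, AddChar.map_neg_eq_inv, hpow, inv_pow]
  have hinv : (ψ 1)⁻¹ ^ (2 * k + 1) = ψ 1 ^ (2 * k + 1) := by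
    rw [inv_pow, inv_eq_of_mul_eq_one_left]
    rw [← hz, ← pow_add]; ring_nf
  rw [sum_Circ_adj (by ring) (smallJumps_bounds ht hk), sum_smallJumps hk]
  simp only [hadd, hsub]
  generalize ψ 1 = z at *
  rw [circEigenvalue, add_mul, add_mul, add_mul, Finset.sum_mul]
  have : ∀ s ∈ Finset.Icc 1 (t - 1), ψ u * z ^ s + ψ u * z⁻¹ ^ s +
      (ψ u * z ^ (2 * k + 1 - s) + ψ u * z⁻¹ ^ (2 * k + 1 - s)) =
      (z ^ s + z⁻¹ ^ s) * (1 + z ^ (2 * k + 1)) * ψ u := by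
    intro s hs
    have hs' : s ≤ 2 * k + 1 := by rw [Finset.mem_Icc] at hs; omega
    rw [pow_sub₀ _ hz0 hs', pow_sub₀ _ (inv_ne_zero hz0) hs', hinv, inv_pow, inv_inv]
    ring
  rw [Finset.sum_congr rfl this]
  ring

open Classical in
lemma circEigenvalue_mul_sum {t k : ℕ} (ht : 1 ≤ t) (hk : t + 1 ≤ k) [NeZero (4 * k + 2)]
    {K : Type*} [Field K]
    {f : ZMod (4 * k + 2) → K} {e : K}
    (hf : ∀ u, ∑ v, (if (Circ (4 * k + 2) (smallJumps t k ∪ {2 * k + 1})).Adj u v then f v else 0) +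
      e * f u = 0) (ψ : AddChar (ZMod (4 * k + 2)) K) :
    (circEigenvalue t k (ψ 1) + e) * ∑ u, ψ u * f u = 0 := by
  have h : ∑ u, ψ u * (∑ v, (if (Circ (4 * k + 2) (smallJumps t k ∪ {2 * k + 1})).Adj u v then
      f v else 0) + e * f u) = 0 := by simp only [hf, mul_zero, Finset.sum_const_zero]
  rw [← h]
  simp only [mul_add, Finset.sum_add_distrib]
  rw [add_mul]
  simp only [Finset.mul_sum]
  rw [Finset.sum_comm (γ := ZMod (4 * k + 2))]
  congr 1
  · refine Finset.sum_congr rfl fun v _ => ?_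
    rw [← mul_assoc, ← sum_circ_addChar ht hk, Finset.sum_mul]
    refine Finset.sum_congr rfl fun u _ => ?_
    simp [SimpleGraph.adj_comm _ u v]
  · exact Finset.sum_congr rfl fun v _ => by ring

lemma eq_zero_of_sum_addChar_mul_eq_zero {n : ℕ} [NeZero n] {f : ZMod n → ℂ}
    (hf : ∀ ψ : AddChar (ZMod n) ℂ, ∑ u, ψ u * f u = 0) : f = 0 := by
  apply (ZMod.dft (N := n) (E := ℂ)).injective
  rw [map_zero]
  funext j
  rw [ZMod.dft_apply, Pi.zero_apply, ← hf (ZMod.stdAddChar.mulShift (-j))]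
  refine Finset.sum_congr rfl fun u _ => ?_
  rw [AddChar.mulShift_apply, smul_eq_mul]
  congr 2
  ring

open Classical in
lemma eigenvector_circ {t k : ℕ} (ht : 1 ≤ t) (hk : t + 1 ≤ k) [NeZero (4 * k + 2)]
    {f : ZMod (4 * k + 2) → ℝ} {e : ℤ} (he : e = 1 ∨ e = -1)
    (hf : ∀ u, ∑ v, (if (Circ (4 * k + 2) (smallJumps t k ∪ {2 * k + 1})).Adj u v then f v else 0) +
      e * f u = 0) :
    (∀ u, f (u + 1) = -f u) ∧ (e = -1 → f = 0) := by
  have hf' : ∀ u, ∑ v, (if (Circ (4 * k + 2) (smallJumps t k ∪ {2 * k + 1})).Adj u v then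
      (f v : ℂ) else 0) + e * (f u : ℂ) = 0 := fun u => by
    have := congrArg ((↑) : ℝ → ℂ) (hf u)
    push_cast [apply_ite ((↑) : ℝ → ℂ)] at this
    exact this
  have hψ (ψ : AddChar (ZMod (4 * k + 2)) ℂ) :
      ∑ u, ψ u * (f u : ℂ) = 0 ∨ ψ 1 = -1 ∧ e = 1 := by
    refine (mul_eq_zero.mp (circEigenvalue_mul_sum ht hk hf' ψ)).symm.imp_right fun h => ?_
    refine eq_of_circEigenvalue ht ?_ he h
    rw [← AddChar.map_nsmul_eq_pow, nsmul_one, ZMod.natCast_self, AddChar.map_zero_eq_one]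
  refine ⟨fun u => ?_, ?_⟩
  · have h0 : (fun u => (f (u + 1) : ℂ) + f u) = 0 := by
      refine eq_zero_of_sum_addChar_mul_eq_zero fun ψ => ?_
      have h1 : ψ 1 * ∑ u, ψ u * (f (u + 1) : ℂ) = ∑ u, ψ u * (f u : ℂ) := by
        rw [← Equiv.sum_comp (Equiv.addRight (1 : ZMod (4 * k + 2))) fun u => ψ u * (f u : ℂ),
          Finset.mul_sum]
        refine Finset.sum_congr rfl fun u _ => ?_
        rw [Equiv.coe_addRight, AddChar.map_add_eq_mul]
        ring
      have hne : ψ 1 ≠ 0 := (ψ.val_isUnit 1).ne_zero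
      apply mul_left_cancel₀ hne
      simp only [mul_add, Finset.sum_add_distrib]
      rw [← mul_add, mul_add, h1]
      rcases hψ ψ with h | ⟨h, -⟩ <;> rw [h] <;> ring
    have := congrFun h0 u
    simp only [Pi.zero_apply] at this
    exact eq_neg_of_add_eq_zero_left (by exact_mod_cast this)
  · rintro rfl
    have h0 : (fun u => (f u : ℂ)) = 0 :=
      eq_zero_of_sum_addChar_mul_eq_zero fun ψ => (hψ ψ).resolve_right (by norm_num)
    funext u
    simpa using congrFun h0 u

open Classical in
lemma adjMatR_boxProd_completeGraph_mulVec {V : Type*} [Fintype V] (G : SimpleGraph V)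
    (x : V × Fin 2 → ℝ) (a : V) (b : Fin 2) :
    (adjMatR (G □ completeGraph (Fin 2))).mulVec x (a, b) =
      ∑ v, (if G.Adj a v then x (v, b) else 0) + x (a, b + 1) := by
  have h1 : x (a, b + 1) = ∑ v, if a = v then x (v, b + 1) else 0 := by simp
  rw [h1, ← Finset.sum_add_distrib, Matrix.mulVec, dotProduct, Fintype.sum_prod_type]
  refine Finset.sum_congr rfl fun v _ => ?_
  fin_cases b <;> simp [adjMatR, Fin.sum_univ_two, boxProd_adj, add_comm]

lemma isNutGraph_of_ker_eq_span {V : Type*} [Fintype V] [Nonempty V] {G : SimpleGraph V}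
    {w : V → ℝ} (hw : ∀ v, w v ≠ 0) (hker : (adjMatR G).mulVec w = 0)
    (hspan : ∀ x, (adjMatR G).mulVec x = 0 → ∃ c : ℝ, x = c • w) : IsNutGraph G := by
  refine ⟨finrank_eq_one_iff'.mpr ⟨⟨w, hker⟩, ?_, ?_⟩, ?_⟩
  · intro h
    exact hw (Classical.arbitrary V) (congrFun (congrArg Subtype.val h) _)
  · rintro ⟨x, hx⟩
    obtain ⟨c, rfl⟩ := hspan x hx
    exact ⟨c, rfl⟩
  · intro x hx hx0 v
    obtain ⟨c, rfl⟩ := hspan x hx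
    have hc : c ≠ 0 := by rintro rfl; simp at hx0
    exact mul_ne_zero hc (hw v)

lemma isNutGraph_circ_boxProd {t k : ℕ} (ht : 1 ≤ t) (hk : t + 1 ≤ k) [NeZero (4 * k + 2)] :
    IsNutGraph (Circ (4 * k + 2) (smallJumps t k ∪ {2 * k + 1}) □ completeGraph (Fin 2)) := by
  classical
  have h1 : (-1 : ℝ) ^ (4 * k + 2) = 1 := Even.neg_one_pow ⟨2 * k + 1, by ring⟩
  set ψ := AddChar.zmodChar (4 * k + 2) h1
  have hψ1 : ψ 1 = -1 := by simpa using AddChar.zmodChar_apply' h1 1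
  have heig : circEigenvalue t k (-1 : ℝ) = -1 := by
    have h2 : (-1 : ℝ) ^ (2 * k + 1) = -1 := Odd.neg_one_pow ⟨k, rfl⟩
    simp [circEigenvalue, h2, pow_succ]
  refine isNutGraph_of_ker_eq_span (w := fun p => ψ p.1) (fun p => (ψ.val_isUnit p.1).ne_zero) ?_ ?_
  · funext ⟨a, b⟩
    rw [adjMatR_boxProd_completeGraph_mulVec, sum_circ_addChar ht hk, hψ1, heig]
    simp
  · intro x hx
    have hx' (a b) := (adjMatR_boxProd_completeGraph_mulVec _ x a b).symm.trans (congrFun hx (a, b))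
    have h0 (a) := hx' a 0
    have h1 (a) := hx' a 1
    simp only [Pi.zero_apply, zero_add, show (1 : Fin 2) + 1 = 0 from rfl] at h0 h1
    have hu := (eigenvector_circ ht hk (f := fun a => x (a, 0) + x (a, 1)) (e := 1) (.inl rfl)
      fun u => by
        rw [Finset.sum_congr rfl fun v _ => ite_add_zero, Finset.sum_add_distrib]
        push_cast
        linear_combination h0 u + h1 u).1
    have hv := (eigenvector_circ ht hk (f := fun a => x (a, 0) - x (a, 1)) (e := -1) (.inr rfl)
      fun u => by
        have (v : ZMod (4 * k + 2)) : (if (Circ (4 * k + 2) (smallJumps t k ∪ {2 * k + 1})).Adj u v then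
            x (v, 0) - x (v, 1) else 0) =
            (if (Circ (4 * k + 2) (smallJumps t k ∪ {2 * k + 1})).Adj u v then x (v, 0) else 0) -
            (if (Circ (4 * k + 2) (smallJumps t k ∪ {2 * k + 1})).Adj u v then x (v, 1) else 0) := by
          split_ifs <;> simp
        rw [Finset.sum_congr rfl fun v _ => this v, Finset.sum_sub_distrib]
        push_cast
        linear_combination h0 u - h1 u).2 rfl
    have hv' (a) : x (a, 1) = x (a, 0) := (sub_eq_zero.mp (congrFun hv a)).symm
    have hpow (n : ℕ) : x (n, 0) = x (0, 0) * ψ n := by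
      induction n with
      | zero => simp
      | succ n ih =>
        have := hu n
        simp only [hv'] at this
        rw [Nat.cast_succ, AddChar.map_add_eq_mul, hψ1]
        linear_combination this / 2 - ih
    refine ⟨x (0, 0), funext fun ⟨a, b⟩ => ?_⟩
    have := hpow a.val
    rw [ZMod.natCast_zmod_val] at this
    fin_cases b
    · exact this
    · exact (hv' a).trans this

lemma isRegularOfDeg_circ_boxProd {t k : ℕ} (ht : 1 ≤ t) (hk : t + 1 ≤ k) [NeZero (4 * k + 2)] :
    IsRegularOfDeg (Circ (4 * k + 2) (smallJumps t k ∪ {2 * k + 1}) □ completeGraph (Fin 2))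
      (4 * t + 2) := by
  classical
  intro p
  rw [Set.ncard_eq_toFinset_card', Set.toFinset_card, card_neighborSet_eq_degree, degree_boxProd]
  have h := sum_Circ_adj (n := 4 * k + 2) (h := 2 * k + 1) (by ring) (smallJumps_bounds ht hk)
    (fun _ => 1) p.1
  rw [sum_smallJumps hk, Finset.sum_boole, Nat.cast_id] at h
  rw [← card_neighborFinset_eq_degree, neighborFinset_eq_filter, h]
  simp
  omega

lemma exists_boxProd_completeGraph_iso_addCayleyGraph {n : ℕ} (S : Finset ℕ) :
    ∃ C : Set (ZMod n × ZMod 2), 0 ∉ C ∧ (∀ c ∈ C, -c ∈ C) ∧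
      Nonempty ((Circ n S □ completeGraph (Fin 2)) ≃g addCayleyGraph C) := by
  refine ⟨{c | (Circ n S).Adj 0 c.1 ∧ c.2 = 0 ∨ c.1 = 0 ∧ c.2 ≠ 0}, by simp, ?_,
    ⟨⟨Equiv.refl (ZMod n × ZMod 2), ?_⟩⟩⟩
  · rintro ⟨a, b⟩ (⟨ha, hb⟩ | ⟨ha, hb⟩)
    · refine .inl ⟨?_, by simpa using hb⟩
      rw [adj_comm]
      simpa [Circ, eq_comm (a := (0 : ZMod n))] using ha
    · exact .inr ⟨by simpa using ha, by simpa using hb⟩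
  · have hC (a c : ZMod n) : (Circ n S).Adj 0 (c - a) ↔ (Circ n S).Adj a c := by
      rw [Circ, ← circulantGraph_adj_translate (d := a), zero_add, sub_add_cancel]
    intro p q
    have hbd {b d : ZMod 2} : b - d = 0 ↔ d = b := sub_eq_zero.trans eq_comm
    have hdb {b d : ZMod 2} : b - d ≠ 0 ↔ d ≠ b := hbd.not
    have hadj (p q : ZMod n × ZMod 2) : q - p ∈ {c : ZMod n × ZMod 2 |
        (Circ n S).Adj 0 c.1 ∧ c.2 = 0 ∨ c.1 = 0 ∧ c.2 ≠ 0} ↔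
        (Circ n S).Adj p.1 q.1 ∧ p.2 = q.2 ∨ p.2 ≠ q.2 ∧ p.1 = q.1 := by
      change (Circ n S).Adj 0 (q.1 - p.1) ∧ q.2 - p.2 = 0 ∨ q.1 - p.1 = 0 ∧ q.2 - p.2 ≠ 0 ↔ _
      rw [hC, hbd, hdb, sub_eq_zero, and_comm (a := q.1 = p.1), eq_comm (a := q.1)]
    refine (fromRel_adj _ _ _).trans ?_
    rw [hadj, hadj, boxProd_adj]
    change _ ↔ _ ∨ p.2 ≠ q.2 ∧ _
    constructor
    · rintro ⟨-, h | ⟨h, h'⟩ | ⟨h, h'⟩⟩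
      · exact h
      · exact .inl ⟨h.symm, h'.symm⟩
      · exact .inr ⟨Ne.symm h, h'.symm⟩
    · intro h
      refine ⟨?_, .inl h⟩
      rintro rfl
      exact h.elim (fun h => (Circ n S).irrefl h.1) fun h => h.1 rfl

/-- For any `t ≥ 1` and `m ≥ 4t + 6` with `m ≡ 2 (mod 4)`, the graph
`Circ(m, {1,…,t-1} ∪ {(m+2)/4, (m+6)/4} ∪ {m/2-(t-1),…,m/2-1} ∪ {m/2}) □ K₂` is a
`(4t+2)`-regular nut graph of order `2m`, and it is a Cayley graph of `ℤ_m × ℤ₂`. -/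
theorem cayley_lemma (t m : ℕ) (ht : 1 ≤ t) (hm : 4 * t + 6 ≤ m) (hmod : m % 4 = 2) :
    haveI : NeZero m := ⟨by omega⟩
    IsRegularOfDeg
        (Circ m (Finset.Icc 1 (t - 1) ∪ {(m + 2) / 4, (m + 6) / 4} ∪
          Finset.Icc (m / 2 - (t - 1)) (m / 2 - 1) ∪ {m / 2}) □ completeGraph (Fin 2))
        (4 * t + 2) ∧
    IsNutGraph
        (Circ m (Finset.Icc 1 (t - 1) ∪ {(m + 2) / 4, (m + 6) / 4} ∪
          Finset.Icc (m / 2 - (t - 1)) (m / 2 - 1) ∪ {m / 2}) □ completeGraph (Fin 2)) ∧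
    Fintype.card (ZMod m × Fin 2) = 2 * m ∧
    ∃ C : Set (ZMod m × ZMod 2), (0 : ZMod m × ZMod 2) ∉ C ∧ (∀ c ∈ C, -c ∈ C) ∧
      Nonempty
        ((Circ m (Finset.Icc 1 (t - 1) ∪ {(m + 2) / 4, (m + 6) / 4} ∪
            Finset.Icc (m / 2 - (t - 1)) (m / 2 - 1) ∪ {m / 2}) □ completeGraph (Fin 2)) ≃g
          addCayleyGraph C) := by
  obtain ⟨k, rfl⟩ : ∃ k, m = 4 * k + 2 := ⟨m / 4, by omega⟩
  have hk : t + 1 ≤ k := by omega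
  have : NeZero (4 * k + 2) := ⟨by omega⟩
  rw [show (4 * k + 2 + 2) / 4 = k + 1 by omega, show (4 * k + 2 + 6) / 4 = k + 2 by omega,
    show (4 * k + 2) / 2 = 2 * k + 1 by omega]
  exact ⟨isRegularOfDeg_circ_boxProd ht hk, isNutGraph_circ_boxProd ht hk,
    by simp [ZMod.card, mul_comm], exists_boxProd_completeGraph_iso_addCayleyGraph _⟩
end

section
/- For every integer d ≥ 6 with d ≡ 2 (mod 4) and every positive integer k, there exists a d-regular Cayley nut graph of order 2d + 8k. -/
open SimpleGraph Matrix Module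

/-! ### Nut graphs and relabelling -/

/-- A graph is a nut graph as soon as its kernel is spanned by a nowhere-zero vector. -/
lemma isNutGraph_of_span {V : Type*} [Fintype V] [Nonempty V] (G : SimpleGraph V) (y : V → ℝ)
    (hy : ∀ v, y v ≠ 0) (hker : (adjMatR G).mulVec y = 0)
    (hspan : ∀ x : V → ℝ, (adjMatR G).mulVec x = 0 → ∃ c : ℝ, x = c • y) : IsNutGraph G := by
  refine ⟨?_, fun x hx hx0 v => ?_⟩
  · refine finrank_eq_one (⟨y, hker⟩ : LinearMap.ker (adjMatR G).mulVecLin) ?_ ?_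
    · intro h
      obtain ⟨v⟩ := ‹Nonempty V›
      exact hy v (congrFun (congrArg Subtype.val h) v)
    · rintro ⟨x, hx⟩
      obtain ⟨c, hc⟩ := hspan x hx
      exact ⟨c, Subtype.ext hc.symm⟩
  · obtain ⟨c, rfl⟩ := hspan x hx
    have hc : c ≠ 0 := by
      rintro rfl
      exact hx0 (zero_smul ℝ y)
    exact mul_ne_zero hc (hy v)

lemma adjMatR_comap_mulVec {V W : Type*} [Fintype V] [Fintype W] (G : SimpleGraph W) (e : V ≃ W)
    (x : V → ℝ) (v : V) :
    (adjMatR (G.comap e)).mulVec x v = (adjMatR G).mulVec (x ∘ e.symm) (e v) := by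
  simp only [Matrix.mulVec, dotProduct, adjMatR, Matrix.of_apply, SimpleGraph.comap_adj]
  exact Fintype.sum_equiv e _ _ (fun w => by rw [Function.comp_apply, e.symm_apply_apply]; rfl)

/-! ### Cayley graphs of additive groups -/

lemma addCayleyGraph_adj {A : Type*} [AddGroup A] {C : Set A} (h0 : (0 : A) ∉ C) (hneg : ∀ c ∈ C, -c ∈ C) (u v : A) :
    (addCayleyGraph C).Adj u v ↔ v - u ∈ C := by
  simp only [addCayleyGraph, SimpleGraph.fromRel_adj]
  constructor
  · rintro ⟨-, h | h⟩
    · exact h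
    · simpa using hneg _ h
  · intro h
    refine ⟨?_, Or.inl h⟩
    rintro rfl
    exact h0 (by simpa using h)

lemma addCayleyGraph_isCayleyGraph {A : Type u} [AddGroup A] [Fintype A] {C : Set A}
    (h0 : (0 : A) ∉ C) (hneg : ∀ c ∈ C, -c ∈ C) : IsCayleyGraph (addCayleyGraph C) := by
  refine ⟨Multiplicative A, inferInstance, inferInstance, Multiplicative.toAdd ⁻¹' C, h0,
    fun c hc => hneg _ hc, ⟨⟨Multiplicative.ofAdd, ?_⟩⟩⟩
  intro u v
  simp [addCayleyGraph, cayleyGraph, sub_eq_add_neg]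

lemma IsCayleyGraph.of_iso {V W : Type u} {G : SimpleGraph V} {H : SimpleGraph W}
    (hH : IsCayleyGraph H) (f : G ≃g H) : IsCayleyGraph G := by
  obtain ⟨Γ, i, j, C, h1, h2, ⟨g⟩⟩ := hH
  exact ⟨Γ, i, j, C, h1, h2, ⟨f.trans g⟩⟩

lemma addCayleyGraph_isRegularOfDeg {A : Type*} [AddCommGroup A] {C : Finset A}
    (h0 : (0 : A) ∉ C) (hneg : ∀ c ∈ C, -c ∈ C) :
    IsRegularOfDeg (addCayleyGraph (C : Set A)) C.card := by
  intro v
  have : (addCayleyGraph (C : Set A)).neighborSet v = (fun c => v + c) '' (C : Set A) := by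
    ext w
    rw [SimpleGraph.mem_neighborSet, addCayleyGraph_adj (by simpa using h0) (by simpa using hneg)]
    constructor
    · intro h
      exact ⟨w - v, h, by simp⟩
    · rintro ⟨c, hc, rfl⟩
      simpa using hc
  rw [this, Set.ncard_image_of_injective _ (add_right_injective v), Set.ncard_coe_finset]

lemma adjMatR_addCayleyGraph_mulVec {A : Type*} [AddCommGroup A] [Fintype A] {C : Finset A}
    (h0 : (0 : A) ∉ C) (hneg : ∀ c ∈ C, -c ∈ C) (x : A → ℝ) (v : A) :
    (adjMatR (addCayleyGraph (C : Set A))).mulVec x v = ∑ c ∈ C, x (v + c) := by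
  classical
  simp only [Matrix.mulVec, dotProduct, adjMatR, Matrix.of_apply,
    addCayleyGraph_adj (C := (C : Set A)) (by simpa using h0) (by simpa using hneg),
    ite_mul, one_mul, zero_mul]
  rw [← Equiv.sum_comp (Equiv.addLeft v)]
  simp [Finset.sum_ite_mem]

/-! ### Circulant operators -/

section Circulant

variable {m : ℕ} [NeZero m] {R : Type*}

/-- The coefficients of `T ^ (h - 1) + T ^ (h + 2) - T ^ h - T ^ (h + 1)`, where `T` is the
generator of `ZMod m`. -/
def midDiff (m : ℕ) (h : ZMod m) (s : ZMod m) : ℤ :=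
  (if s = h - 1 then 1 else 0) + (if s = h + 2 then 1 else 0) - (if s = h then 1 else 0)
    - (if s = h + 1 then 1 else 0)

lemma sum_midDiff_mul [CommRing R] (h : ZMod m) (f : ZMod m → R) (z : ZMod m) :
    ∑ s, (midDiff m h s : R) * f (z + s)
      = f (z + (h - 1)) + f (z + (h + 2)) - f (z + h) - f (z + (h + 1)) := by
  simp [midDiff, sub_mul, add_mul, Finset.sum_add_distrib, Finset.sum_sub_distrib]

lemma ZMod.eq_of_forall_add_one_eq {α : Type*} (f : ZMod m → α) (hf : ∀ z, f (z + 1) = f z)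
    (z : ZMod m) : f z = f 0 := by
  have key : ∀ n : ℕ, f (n : ZMod m) = f 0 := by
    intro n
    induction n with
    | zero => simp
    | succ n ih => rw [Nat.cast_succ, hf, ih]
  simpa using key z.val

lemma eq_const_of_midDiff [CommRing R] [IsDomain R] (hm : Odd m) (hR : (m : R) ≠ 0) (h : ZMod m)
    (f : ZMod m → R) (hf : ∀ z, ∑ s, (midDiff m h s : R) * f (z + s) = 0) (z : ZMod m) :
    f z = f 0 := by
  have hf' : ∀ w, f (w + 3) - f (w + 1) = f (w + 2) - f w := by
    intro w
    have := hf (w - (h - 1))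
    rw [sum_midDiff_mul] at this
    rw [show w - (h - 1) + (h - 1) = w by ring, show w - (h - 1) + (h + 2) = w + 3 by ring,
      show w - (h - 1) + h = w + 1 by ring, show w - (h - 1) + (h + 1) = w + 2 by ring] at this
    linear_combination this
  have hc := ZMod.eq_of_forall_add_one_eq (fun w => f (w + 2) - f w) (fun w => by
    have := hf' w
    rwa [show w + 1 + 2 = w + 3 by ring])
  have hsum : ∑ w, (f (w + 2) - f w) = 0 := by
    rw [Finset.sum_sub_distrib, sub_eq_zero]
    exact Equiv.sum_comp (Equiv.addRight (2 : ZMod m)) f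
  have hzero : f (0 + 2) - f 0 = 0 := by
    rw [Finset.sum_congr rfl (fun w _ => hc w)] at hsum
    rw [Finset.sum_const, Finset.card_univ, ZMod.card, nsmul_eq_mul] at hsum
    exact (mul_eq_zero.mp hsum).resolve_left hR
  have htwo : ∀ w, f (w + 2) = f w := fun w => sub_eq_zero.mp ((hc w).trans hzero)
  have heven : ∀ (n : ℕ) w, f (w + 2 * n) = f w := by
    intro n
    induction n with
    | zero => simp
    | succ n ih =>
      intro w
      rw [show w + 2 * ((n + 1 : ℕ) : ZMod m) = w + 2 * n + 2 by push_cast; ring, htwo, ih]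
  obtain ⟨r, hr⟩ := hm
  refine ZMod.eq_of_forall_add_one_eq f (fun w => ?_) z
  have hr' : (2 * (r : ZMod m) + 1) = 0 := by
    have := ZMod.natCast_self m
    rw [congrArg (Nat.cast : ℕ → ZMod m) hr] at this
    exact_mod_cast this
  rw [← heven (r + 1) w]
  congr 1
  push_cast
  linear_combination -hr'

lemma sum_sum_mul_add [CommRing R] (a f : ZMod m → R) :
    ∑ z, ∑ s, a s * f (z + s) = (∑ s, a s) * ∑ z, f z := by
  rw [Finset.sum_comm, Finset.sum_mul]
  refine Finset.sum_congr rfl fun s _ => ?_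
  rw [← Finset.mul_sum]
  congr 1
  exact Equiv.sum_comp (Equiv.addRight s) f

/-- A circulant integer operator with nonzero row sum that is congruent to `midDiff` modulo `2`
is nonsingular. -/
lemma eq_zero_of_modEq_midDiff (hm : Odd m) (h : ZMod m) (a : ZMod m → ℤ)
    (ha : ∀ s, (a s : ZMod 2) = midDiff m h s) (hsum : ∑ s, a s ≠ 0) (f : ZMod m → ℝ)
    (hf : ∀ z, ∑ s, (a s : ℝ) * f (z + s) = 0) : f = 0 := by
  have hm2 : (m : ZMod 2) = 1 := (ZMod.natCast_eq_one_iff_odd).mpr hm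
  let N : Matrix (ZMod m) (ZMod m) ℤ := Matrix.of fun i j => a (j - i) + 1
  have hN : ∀ {R : Type} [CommRing R] (g : ZMod m → R) (z : ZMod m),
      (N.map (Int.castRingHom R)).mulVec g z = ∑ s, (a s : R) * g (z + s) + ∑ s, g s := by
    intro R _ g z
    simp only [Matrix.mulVec, dotProduct, Matrix.map_apply, N, Matrix.of_apply]
    rw [← Equiv.sum_comp (Equiv.addLeft z), ← Equiv.sum_comp (Equiv.addLeft z) g, ← Finset.sum_add_distrib]
    refine Finset.sum_congr rfl fun s _ => ?_
    simp [add_mul]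
  have hdet : N.det ≠ 0 := by
    intro h0
    have h2 : (N.map (Int.castRingHom (ZMod 2))).det = 0 := by
      have := RingHom.map_det (Int.castRingHom (ZMod 2)) N
      rw [h0, map_zero] at this
      exact this.symm
    obtain ⟨g, hg0, hg⟩ := Matrix.exists_mulVec_eq_zero_iff.mpr h2
    have hg' : ∀ z, ∑ s, (midDiff m h s : ZMod 2) * g (z + s) + ∑ s, g s = 0 := by
      intro z
      have := congrFun hg z
      rw [hN] at this
      simpa [ha] using this
    have hmid : ∑ s, (midDiff m h s : ZMod 2) = 0 := by
      simpa using sum_midDiff_mul h (fun _ => (1 : ZMod 2)) 0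
    have hgs : ∑ s, g s = 0 := by
      have h3 : ∑ z, (∑ s, (midDiff m h s : ZMod 2) * g (z + s) + ∑ s, g s) = 0 :=
        Finset.sum_eq_zero fun z _ => hg' z
      rw [Finset.sum_add_distrib, sum_sum_mul_add, hmid] at h3
      simpa [ZMod.card, hm2] using h3
    have hconst := eq_const_of_midDiff hm (by simp [hm2]) h g
      (fun z => by simpa [hgs] using hg' z)
    have hg00 : g 0 = 0 := by
      rw [Finset.sum_congr rfl (fun s _ => hconst s)] at hgs
      simpa [ZMod.card, hm2] using hgs
    exact hg0 (funext fun z => by rw [hconst z, hg00, Pi.zero_apply])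
  have hfs : ∑ s, f s = 0 := by
    have h3 : ∑ z, ∑ s, (a s : ℝ) * f (z + s) = 0 := Finset.sum_eq_zero fun z _ => hf z
    rw [sum_sum_mul_add] at h3
    refine (mul_eq_zero.mp h3).resolve_left ?_
    exact_mod_cast hsum
  by_contra hf0
  have hdetR : (N.map (Int.castRingHom ℝ)).det = 0 :=
    Matrix.exists_mulVec_eq_zero_iff.mp ⟨f, hf0, funext fun z => by rw [hN, hf, hfs]; simp⟩
  have := RingHom.map_det (Int.castRingHom ℝ) N
  rw [RingHom.mapMatrix_apply, hdetR] at this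
  exact hdet (by simpa using this)

end Circulant

/-! ### The connection set -/

section Construction

variable {m : ℕ}

/-- The connection set in `ZMod m × ZMod 2 × ZMod 2` built from a core `Q` and the four
consecutive elements `h - 1, h, h + 1, h + 2`. -/
def nutConnSet (Q : Finset (ZMod m)) (h : ZMod m) : Finset (ZMod m × ZMod 2 × ZMod 2) :=
  (Q.erase 0 ∪ {h, h + 1}) ×ˢ {(0, 0)} ∪
    ({(0, 1, 0)} ∪ (Q ∪ {h - 1, h + 2}) ×ˢ {(0, 1)})

/-- The conditions on `Q` and `h` making `nutConnSet Q h` a suitable connection set. -/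
structure IsNutCore (Q : Finset (ZMod m)) (h : ZMod m) : Prop where
  two_mul_add_one : 2 * h + 1 = 0
  one_ne : (1 : ZMod m) ≠ 0
  three_ne : (3 : ZMod m) ≠ 0
  zero_mem : 0 ∈ Q
  neg_mem : ∀ q ∈ Q, -q ∈ Q
  sub_one_notMem : h - 1 ∉ Q
  notMem : h ∉ Q
  add_one_notMem : h + 1 ∉ Q
  add_two_notMem : h + 2 ∉ Q

variable {Q : Finset (ZMod m)} {h : ZMod m}

lemma IsNutCore.sum_nutConnSet {M : Type*} [AddCommGroup M] (H : IsNutCore Q h)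
    (F : ZMod m × ZMod 2 × ZMod 2 → M) :
    ∑ c ∈ nutConnSet Q h, F c
      = (∑ q ∈ Q, F (q, 0, 0) - F (0, 0, 0) + (F (h, 0, 0) + F (h + 1, 0, 0)))
        + (F (0, 1, 0) + (∑ q ∈ Q, F (q, 0, 1) + (F (h - 1, 0, 1) + F (h + 2, 0, 1)))) := by
  have hne : h ≠ h + 1 := fun e => H.one_ne (by simpa using e.symm)
  have hne' : h - 1 ≠ h + 2 := fun e => H.three_ne (by linear_combination -e)
  unfold nutConnSet
  rw [Finset.sum_union, Finset.sum_union, Finset.sum_product, Finset.sum_product,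
    Finset.sum_union, Finset.sum_union, Finset.sum_pair hne, Finset.sum_pair hne',
    Finset.sum_erase_eq_sub H.zero_mem]
  · simp
  · simp [H.sub_one_notMem, H.add_two_notMem]
  · simp [H.notMem, H.add_one_notMem]
  · simp
  · rw [Finset.disjoint_left]
    rintro ⟨z, i, j⟩
    simp only [Finset.mem_union, Finset.mem_product, Finset.mem_singleton, Prod.mk.injEq]
    rintro ⟨-, rfl, rfl⟩
    simp

lemma IsNutCore.card_nutConnSet (H : IsNutCore Q h) :
    (nutConnSet Q h).card = 2 * Q.card + 4 := by
  have := H.sum_nutConnSet (fun _ => (1 : ℤ))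
  simp only [Finset.sum_const, nsmul_eq_mul, mul_one] at this
  omega

lemma IsNutCore.zero_notMem_nutConnSet (H : IsNutCore Q h) : 0 ∉ nutConnSet Q h := by
  have h1 : (0 : ZMod m) ≠ h := fun e => H.notMem (e ▸ H.zero_mem)
  have h2 : (0 : ZMod m) ≠ h + 1 := fun e => H.add_one_notMem (e ▸ H.zero_mem)
  simp [nutConnSet, Prod.ext_iff, h1, h2]

lemma IsNutCore.neg_mem_nutConnSet (H : IsNutCore Q h) :
    ∀ c ∈ nutConnSet Q h, -c ∈ nutConnSet Q h := by
  have h1 : -h = h + 1 := by linear_combination -H.two_mul_add_one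
  have h2 : -(h + 1) = h := by linear_combination -H.two_mul_add_one
  have h3 : -(h - 1) = h + 2 := by linear_combination -H.two_mul_add_one
  have h4 : -(h + 2) = h - 1 := by linear_combination -H.two_mul_add_one
  have h5 : (-1 : ZMod 2) = 1 := rfl
  rintro ⟨z, i, j⟩
  simp only [nutConnSet, Finset.mem_union, Finset.mem_product, Finset.mem_singleton,
    Finset.mem_erase, Finset.mem_insert, Prod.mk.injEq, Prod.neg_mk]
  rintro (⟨(⟨h0, hz⟩ | rfl | rfl), rfl, rfl⟩ | ⟨rfl, rfl, rfl⟩ | ⟨(hz | rfl | rfl), rfl, rfl⟩)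
  · simp [h0, H.neg_mem z hz]
  · simp [h1]
  · rw [h2]; simp
  · simp [h5]
  · simp [H.neg_mem z hz, h5]
  · rw [h3]; simp [h5]
  · rw [h4]; simp [h5]

/-- The kernel equation of the graph, twisted by a pair of signs on `ZMod 2 × ZMod 2` other than
`(1, -1)`, has only the zero solution. -/
lemma eq_zero_of_twisted_eq [NeZero m] (hm : Odd m) (α β : ℤ) (hα : Odd α) (hβ : Odd β)
    (hsum : Q.card * (1 + β) + α + 1 + 2 * β ≠ 0) (g : ZMod m → ℝ)
    (hg : ∀ z, (1 + β) * ∑ q ∈ Q, g (z + q) + (α - 1) * g z + g (z + h) + g (z + (h + 1))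
      + β * (g (z + (h - 1)) + g (z + (h + 2))) = 0) : g = 0 := by
  have hα' : (α : ZMod 2) = 1 := ZMod.intCast_eq_one_iff_odd.mpr hα
  have hβ' : (β : ZMod 2) = 1 := ZMod.intCast_eq_one_iff_odd.mpr hβ
  have h2 : (2 : ZMod 2) = 0 := rfl
  refine eq_zero_of_modEq_midDiff hm h (fun s => (1 + β) * (if s ∈ Q then 1 else 0)
    + (α - 1) * (if s = 0 then 1 else 0) + (if s = h then 1 else 0)
    + (if s = h + 1 then 1 else 0)
    + β * ((if s = h - 1 then 1 else 0) + (if s = h + 2 then 1 else 0))) ?_ ?_ g ?_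
  · intro s
    simp only [midDiff]
    push_cast
    rw [hα', hβ']
    linear_combination ((if s ∈ Q then 1 else 0) + (if s = h then 1 else 0)
      + (if s = h + 1 then 1 else 0)) * h2
  · convert hsum using 1
    simp [Finset.sum_add_distrib, ← Finset.mul_sum]
    ring
  · intro z
    rw [← hg z]
    push_cast
    simp only [add_mul, mul_assoc, Finset.sum_add_distrib, ← Finset.mul_sum, ite_mul, one_mul,
      zero_mul, Finset.sum_ite_mem, Finset.sum_ite_eq', Finset.univ_inter, Finset.mem_univ,
      if_true, add_zero]

lemma IsNutCore.exists_kernel_generator [NeZero m] (hm : Odd m) (H : IsNutCore Q h) :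
    ∃ y : ZMod m × ZMod 2 × ZMod 2 → ℝ, (∀ v, y v ≠ 0) ∧
      (∀ v, ∑ c ∈ nutConnSet Q h, y (v + c) = 0) ∧
      ∀ x : ZMod m × ZMod 2 × ZMod 2 → ℝ, (∀ v, ∑ c ∈ nutConnSet Q h, x (v + c) = 0) →
        ∃ a : ℝ, x = a • y := by
  have hcases : ∀ i : ZMod 2, i = 0 ∨ i = 1 := by decide
  have h11 : (1 + 1 : ZMod 2) = 0 := rfl
  refine ⟨fun v => if v.2.2 = 0 then 1 else -1, ?_, ?_, ?_⟩
  · intro v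
    dsimp only
    split_ifs <;> norm_num
  · rintro ⟨z, i, j⟩
    rw [H.sum_nutConnSet]
    rcases hcases j with rfl | rfl
    · simp
      ring
    · simp [h11]
      ring
  · intro x hx
    have E : ∀ z i j, (∑ q ∈ Q, x (z + q, i, j) - x (z, i, j)
        + (x (z + h, i, j) + x (z + (h + 1), i, j)))
        + (x (z, i + 1, j) + (∑ q ∈ Q, x (z + q, i, j + 1)
        + (x (z + (h - 1), i, j + 1) + x (z + (h + 2), i, j + 1)))) = 0 := by
      intro z i j
      have := hx (z, i, j)
      rw [H.sum_nutConnSet] at this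
      simpa using this
    have E00 := fun z => E z 0 0
    have E10 := fun z => E z 1 0
    have E01 := fun z => E z 0 1
    have E11 := fun z => E z 1 1
    simp only [h11, zero_add] at E00 E10 E01 E11
    have hpp := eq_zero_of_twisted_eq (Q := Q) (h := h) hm 1 1 (by decide) (by decide) (by omega)
      (fun z => x (z, 0, 0) + x (z, 1, 0) + x (z, 0, 1) + x (z, 1, 1)) (fun z => by
        simp only [Finset.sum_add_distrib]
        push_cast
        linear_combination E00 z + E10 z + E01 z + E11 z)
    have hnp := eq_zero_of_twisted_eq (Q := Q) (h := h) hm (-1) 1 (by decide) (by decide)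
      (by omega) (fun z => x (z, 0, 0) - x (z, 1, 0) + x (z, 0, 1) - x (z, 1, 1)) (fun z => by
        simp only [Finset.sum_add_distrib, Finset.sum_sub_distrib]
        push_cast
        linear_combination E00 z - E10 z + E01 z - E11 z)
    have hnn := eq_zero_of_twisted_eq (Q := Q) (h := h) hm (-1) (-1) (by decide) (by decide)
      (by omega) (fun z => x (z, 0, 0) - x (z, 1, 0) - x (z, 0, 1) + x (z, 1, 1)) (fun z => by
        simp only [Finset.sum_add_distrib, Finset.sum_sub_distrib]
        push_cast
        linear_combination E00 z - E10 z - E01 z + E11 z)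
    have hpn := eq_const_of_midDiff hm (Nat.cast_ne_zero.mpr (NeZero.ne m)) h
      (fun z => x (z, 0, 0) + x (z, 1, 0) - x (z, 0, 1) - x (z, 1, 1)) (fun z => by
        refine (sum_midDiff_mul h
          (fun z => x (z, 0, 0) + x (z, 1, 0) - x (z, 0, 1) - x (z, 1, 1)) z).trans ?_
        linear_combination -(E00 z + E10 z - E01 z - E11 z))
    refine ⟨(x (0, 0, 0) + x (0, 1, 0) - x (0, 0, 1) - x (0, 1, 1)) / 4, funext ?_⟩
    rintro ⟨z, i, j⟩
    have p1 := congrFun hpp z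
    have p2 := congrFun hnp z
    have p3 := congrFun hnn z
    have p4 := hpn z
    simp only [Pi.zero_apply] at p1 p2 p3 p4
    rcases hcases i with rfl | rfl <;> rcases hcases j with rfl | rfl <;>
      simp only [Pi.smul_apply, smul_eq_mul, if_true, one_ne_zero, if_false]
    · linear_combination (p1 + p2 + p3 + p4) / 4
    · linear_combination (p1 + p2 - p3 - p4) / 4
    · linear_combination (p1 - p2 - p3 + p4) / 4
    · linear_combination (p1 - p2 + p3 - p4) / 4

/-- The image in `ZMod m` of the integer interval from `-r` to `r`. -/
noncomputable def centredInterval (m r : ℕ) : Finset (ZMod m) :=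
  (Finset.Icc (-r : ℤ) r).image (fun i : ℤ => (i : ZMod m))

lemma intCast_mem_centredInterval_iff {m r : ℕ} (x : ℤ) :
    (x : ZMod m) ∈ centredInterval m r ↔ ∃ i : ℤ, -r ≤ i ∧ i ≤ r ∧ (m : ℤ) ∣ x - i := by
  simp only [centredInterval, Finset.mem_image, Finset.mem_Icc, ZMod.intCast_eq_intCast_iff_dvd_sub,
    and_assoc]

lemma card_centredInterval {m r : ℕ} (hr : 2 * r < m) : (centredInterval m r).card = 2 * r + 1 := by
  rw [centredInterval, Finset.card_image_of_injOn, Int.card_Icc]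
  · omega
  · intro i hi j hj hij
    simp only [Finset.coe_Icc, Set.mem_Icc] at hi hj
    have := Int.eq_zero_of_abs_lt_dvd ((ZMod.intCast_eq_intCast_iff_dvd_sub i j m).mp hij)
      (by rw [abs_lt]; omega)
    omega

lemma isNutCore_centredInterval (r k : ℕ) (hk : 1 ≤ k) :
    IsNutCore (centredInterval (2 * r + 3 + 2 * k) r) ((r + 1 + k : ℕ) : ZMod _) := by
  have hnot : ∀ x : ℤ, r < x → x < r + 3 + 2 * k →
      (x : ZMod (2 * r + 3 + 2 * k)) ∉ centredInterval (2 * r + 3 + 2 * k) r := by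
    intro x h1 h2 hx
    obtain ⟨i, hi1, hi2, hd⟩ := (intCast_mem_centredInterval_iff x).mp hx
    have := Int.eq_zero_of_abs_lt_dvd hd (by rw [abs_lt]; push_cast; omega)
    omega
  have hne : ∀ a : ℕ, 0 < a → a < 5 → (a : ZMod (2 * r + 3 + 2 * k)) ≠ 0 := by
    intro a h0 h5 h
    have := Nat.le_of_dvd h0 ((ZMod.natCast_eq_zero_iff _ _).mp h)
    omega
  refine ⟨?_, ?_, ?_, ?_, ?_, ?_, ?_, ?_, ?_⟩
  · have := ZMod.natCast_self (2 * r + 3 + 2 * k)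
    push_cast at this ⊢
    linear_combination this
  · simpa using hne 1 (by norm_num) (by norm_num)
  · simpa using hne 3 (by norm_num) (by norm_num)
  · exact Finset.mem_image.mpr ⟨0, by simp, by simp⟩
  · intro q hq
    obtain ⟨i, hi, rfl⟩ := Finset.mem_image.mp hq
    rw [Finset.mem_Icc] at hi
    exact Finset.mem_image.mpr ⟨-i, by rw [Finset.mem_Icc]; omega, by simp⟩
  · have := hnot (r + k) (by omega) (by omega)
    push_cast at this ⊢
    rwa [show (r + 1 + k - 1 : ZMod (2 * r + 3 + 2 * k)) = r + k by ring]
  · have := hnot (r + 1 + k) (by omega) (by omega)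
    push_cast at this ⊢
    exact this
  · have := hnot (r + 1 + k + 1) (by omega) (by omega)
    push_cast at this ⊢
    exact this
  · have := hnot (r + 1 + k + 2) (by omega) (by omega)
    push_cast at this ⊢
    exact this

end Construction

/-- For every `d ≥ 6` with `d ≡ 2 (mod 4)` and every `k ≥ 1`, there exists a `d`-regular
Cayley nut graph of order `2d + 8k`. -/
theorem cayley_nut_orders (d : ℕ) (hd : 6 ≤ d) (hmod : d % 4 = 2) (k : ℕ) (hk : 1 ≤ k) :
    ∃ G : SimpleGraph (Fin (2 * d + 8 * k)),
      IsRegularOfDeg G d ∧ IsNutGraph G ∧ IsCayleyGraph G := by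
  obtain ⟨r, rfl⟩ : ∃ r, d = 4 * r + 6 := ⟨d / 4 - 1, by omega⟩
  have H := isNutCore_centredInterval r k hk
  set m := 2 * r + 3 + 2 * k with hmdef
  have : NeZero m := ⟨by omega⟩
  have hodd : Odd m := ⟨r + 1 + k, by omega⟩
  have hcard := card_centredInterval (m := m) (r := r) (by omega)
  set Q := centredInterval m r
  set h : ZMod m := ((r + 1 + k : ℕ) : ZMod m)
  have h0 := H.zero_notMem_nutConnSet
  have hneg := H.neg_mem_nutConnSet
  have e : Fin (2 * (4 * r + 6) + 8 * k) ≃ ZMod m × ZMod 2 × ZMod 2 :=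
    (Fintype.equivFinOfCardEq (by simp [ZMod.card]; omega)).symm
  let G := addCayleyGraph (nutConnSet Q h : Set (ZMod m × ZMod 2 × ZMod 2))
  let f : G.comap e ≃g G := SimpleGraph.Iso.comap e G
  refine ⟨G.comap e, fun v => ?_, ?_,
    (addCayleyGraph_isCayleyGraph (by simpa using h0) (by simpa using hneg)).of_iso f⟩
  · have hreg := addCayleyGraph_isRegularOfDeg h0 hneg (e v)
    rw [H.card_nutConnSet, hcard] at hreg
    rw [← Nat.card_coe_set_eq] at hreg ⊢
    rw [Nat.card_congr (f.mapNeighborSet v)]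
    exact hreg.trans (by ring)
  · obtain ⟨y, hy, hky, hspan⟩ := H.exists_kernel_generator hodd
    have hmul : ∀ (x : Fin (2 * (4 * r + 6) + 8 * k) → ℝ) (v : Fin (2 * (4 * r + 6) + 8 * k)),
        (adjMatR (G.comap e)).mulVec x v = ∑ c ∈ nutConnSet Q h, (x ∘ e.symm) (e v + c) := by
      intro x v
      rw [adjMatR_comap_mulVec, adjMatR_addCayleyGraph_mulVec h0 hneg]
    have : Nonempty (Fin (2 * (4 * r + 6) + 8 * k)) := ⟨e.symm 0⟩
    refine isNutGraph_of_span _ (y ∘ e) (fun v => hy (e v)) (funext fun v => ?_) fun x hx => ?_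
    · rw [hmul]
      simpa using hky (e v)
    · obtain ⟨a, ha⟩ := hspan (x ∘ e.symm) fun v => by
        have := congrFun hx (e.symm v)
        rw [hmul, e.apply_symm_apply] at this
        exact this
      refine ⟨a, funext fun v => ?_⟩
      simpa using congrFun ha (e v)
end

section
/- Let G be the graph on vertex set {0, 1, …, 9} with edge set {01, 13, 32, 20, 45, 46, 67, 75, 72, 25, 50, 04, 41, 16, 63, 37, 90, 91, 92, 93, 84, 85, 86, 87, 89} (the square antiprism on {0,…,7} together with vertex 9 joined to 0,1,2,3, vertex 8 joined to 4,5,6,7, and the edge 89). Then G is a 5-regular nut graph of order 10. -/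
open SimpleGraph Matrix Module

/-- The edge list of the example graph: the square antiprism on `{0,…,7}` together with
vertex `9` joined to `0,1,2,3`, vertex `8` joined to `4,5,6,7`, and the edge `89`. -/
def exampleEdges : List (ℕ × ℕ) :=
  [(0,1),(1,3),(3,2),(2,0),(4,5),(4,6),(6,7),(7,5),(7,2),(2,5),(5,0),(0,4),
   (4,1),(1,6),(6,3),(3,7),(9,0),(9,1),(9,2),(9,3),(8,4),(8,5),(8,6),(8,7),(8,9)]

/-- The example graph `G` on `10` vertices. -/
def exampleGraph : SimpleGraph (Fin 10) :=
  SimpleGraph.fromRel (fun u v => ((u : ℕ), (v : ℕ)) ∈ exampleEdges)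

/-- Adjacency in the example graph, as a decidable condition on labels. -/
theorem exampleGraph_adj (u v : Fin 10) : exampleGraph.Adj u v ↔
    u ≠ v ∧ (((u : ℕ), (v : ℕ)) ∈ exampleEdges ∨ ((v : ℕ), (u : ℕ)) ∈ exampleEdges) :=
  SimpleGraph.fromRel_adj _ u v

theorem exampleGraph_isRegularOfDeg : IsRegularOfDeg exampleGraph 5 := by
  intro v
  have h : exampleGraph.neighborSet v = ((Finset.univ.filter fun w : Fin 10 =>
      v ≠ w ∧ (((v : ℕ), (w : ℕ)) ∈ exampleEdges ∨ ((w : ℕ), (v : ℕ)) ∈ exampleEdges) :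
        Finset (Fin 10)) : Set (Fin 10)) := by
    ext w
    simp [exampleGraph_adj]
  rw [h, Set.ncard_coe_finset]
  clear h
  revert v
  decide

/-- The `0`-`1` table of adjacencies in the example graph. -/
def exampleTable : Matrix (Fin 10) (Fin 10) ℕ :=
    !![0, 1, 1, 0, 1, 1, 0, 0, 0, 1;
      1, 0, 0, 1, 1, 0, 1, 0, 0, 1;
      1, 0, 0, 1, 0, 1, 0, 1, 0, 1;
      0, 1, 1, 0, 0, 0, 1, 1, 0, 1;
      1, 1, 0, 0, 0, 1, 1, 0, 1, 0;
      1, 0, 1, 0, 1, 0, 0, 1, 1, 0;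
      0, 1, 0, 1, 1, 0, 0, 1, 1, 0;
      0, 0, 1, 1, 0, 1, 1, 0, 1, 0;
      0, 0, 0, 0, 1, 1, 1, 1, 0, 1;
      1, 1, 1, 1, 0, 0, 0, 0, 1, 0]

theorem adjMatR_exampleGraph : adjMatR exampleGraph = exampleTable.map Nat.cast := by
  have key : ∀ u v : Fin 10, exampleTable u v =
      if u ≠ v ∧ (((u : ℕ), (v : ℕ)) ∈ exampleEdges ∨ ((v : ℕ), (u : ℕ)) ∈ exampleEdges)
        then 1 else 0 := by
    intro u v
    fin_cases u <;> fin_cases v <;> rfl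
  ext u v
  simp only [adjMatR, Matrix.of_apply, Matrix.map_apply, key, exampleGraph_adj]
  split_ifs <;> simp

/-- The kernel equations of the example graph, solved in terms of the entry at vertex `0`. -/
theorem adjMatR_exampleGraph_mulVec_eq_zero_iff (x : Fin 10 → ℝ) :
    (adjMatR exampleGraph).mulVec x = 0 ↔ x = x 0 • ![1, 1, 1, 1, 1, 1, 1, 1, -4, -4] := by
  have hL : (adjMatR exampleGraph).mulVec x = 0 ↔
      x 1 + x 2 + x 4 + x 5 + x 9 = 0 ∧ x 0 + x 3 + x 4 + x 6 + x 9 = 0 ∧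
      x 0 + x 3 + x 5 + x 7 + x 9 = 0 ∧ x 1 + x 2 + x 6 + x 7 + x 9 = 0 ∧
      x 0 + x 1 + x 5 + x 6 + x 8 = 0 ∧ x 0 + x 2 + x 4 + x 7 + x 8 = 0 ∧
      x 1 + x 3 + x 4 + x 7 + x 8 = 0 ∧ x 2 + x 3 + x 5 + x 6 + x 8 = 0 ∧
      x 4 + x 5 + x 6 + x 7 + x 9 = 0 ∧ x 0 + x 1 + x 2 + x 3 + x 8 = 0 := by
    rw [adjMatR_exampleGraph]
    simp [funext_iff, Fin.forall_fin_succ, Matrix.mulVec, dotProduct, Fin.sum_univ_succ,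
      exampleTable, Fin.succ, ← add_assoc]
  have hR : x = x 0 • ![1, 1, 1, 1, 1, 1, 1, 1, -4, -4] ↔
      x 1 = x 0 ∧ x 2 = x 0 ∧ x 3 = x 0 ∧ x 4 = x 0 ∧ x 5 = x 0 ∧ x 6 = x 0 ∧ x 7 = x 0 ∧
      x 8 = x 0 * -4 ∧ x 9 = x 0 * -4 := by
    simp [funext_iff, Fin.forall_fin_succ, Fin.succ]
  rw [hL, hR]
  constructor
  · rintro ⟨h0, h1, h2, h3, h4, h5, h6, h7, h8, h9⟩
    refine ⟨?_, ?_, ?_, ?_, ?_, ?_, ?_, ?_, ?_⟩ <;> linarith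
  · rintro ⟨h1, h2, h3, h4, h5, h6, h7, h8, h9⟩
    refine ⟨?_, ?_, ?_, ?_, ?_, ?_, ?_, ?_, ?_, ?_⟩ <;> linarith

theorem exampleGraph_isNutGraph : IsNutGraph exampleGraph := by
  constructor
  · have h : LinearMap.ker (adjMatR exampleGraph).mulVecLin =
        Submodule.span ℝ {(![1, 1, 1, 1, 1, 1, 1, 1, -4, -4] : Fin 10 → ℝ)} := by
      ext x
      rw [LinearMap.mem_ker, Matrix.mulVecLin_apply, adjMatR_exampleGraph_mulVec_eq_zero_iff,
        Submodule.mem_span_singleton]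
      constructor
      · exact fun hx => ⟨x 0, hx.symm⟩
      · rintro ⟨c, rfl⟩
        simp
    rw [h]
    exact finrank_span_singleton fun h0 => one_ne_zero (congrFun h0 0)
  · intro x hx hne v hv
    rw [adjMatR_exampleGraph_mulVec_eq_zero_iff] at hx
    have h0 : x 0 = 0 := by
      have hv' := (congrFun hx v).symm.trans hv
      fin_cases v <;> simpa using hv'
    exact hne (by rw [hx, h0, zero_smul])

/-- The example graph is a `5`-regular nut graph of order `10`. -/
theorem exampleGraph_is_nut :
    IsRegularOfDeg exampleGraph 5 ∧ IsNutGraph exampleGraph ∧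
      Fintype.card (Fin 10) = 10 := by
  exact ⟨exampleGraph_isRegularOfDeg, exampleGraph_isNutGraph, Fintype.card_fin 10⟩
end

section
/- No root of unity is a root of the polynomial x^6 + 2x^5 − x^4 − x^2 + 2x + 1; equivalently, this polynomial is not divisible by the cyclotomic polynomial Φ_b(x) for any positive integer b. -/
open SimpleGraph Matrix Module

open Polynomial in
/-- An integer polynomial vanishing at a root of unity vanishes at its powers with exponent
coprime to the order. -/
theorem IsPrimitiveRoot.aeval_pow_eq_zero_of_coprime {ζ : ℂ} {n k : ℕ}
    (h : IsPrimitiveRoot ζ n) (hk : k.Coprime n) {p : ℤ[X]} (hp : aeval ζ p = 0) :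
    aeval (ζ ^ k) p = 0 := by
  rcases Nat.eq_zero_or_pos n with rfl | hn
  · rw [Nat.coprime_zero_right] at hk
    simpa [hk] using hp
  · obtain ⟨q, hq⟩ := minpoly.isIntegrallyClosed_dvd (h.isIntegral hn) hp
    rw [hq, h.minpoly_eq_pow_coprime hk, map_mul, minpoly.aeval, zero_mul]

/-- The substitution `y = ζ + ζ⁻¹` turns the palindromic sextic into a cubic. -/
theorem cubic_add_inv_eq_zero {ζ : ℂ} (h0 : ζ ≠ 0)
    (h : ζ ^ 6 + 2 * ζ ^ 5 - ζ ^ 4 - ζ ^ 2 + 2 * ζ + 1 = 0) :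
    (ζ + ζ⁻¹) ^ 3 + 2 * (ζ + ζ⁻¹) ^ 2 - 4 * (ζ + ζ⁻¹) - 4 = 0 := by
  field_simp
  linear_combination h

theorem IsPrimitiveRoot.pow_half_eq_neg_one {ζ : ℂ} {m : ℕ} (hm : 0 < m)
    (h : IsPrimitiveRoot ζ (2 * m)) : ζ ^ m = -1 := by
  have h2 : (ζ ^ m) ^ 2 = 1 := by rw [← pow_mul, mul_comm, h.pow_eq_one]
  exact (sq_eq_one_iff.mp h2).resolve_left (h.pow_ne_one_of_pos_of_lt hm.ne' (by omega))

theorem sextic_ne_zero_of_isPrimitiveRoot {ζ : ℂ} {n : ℕ} (hn : 0 < n)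
    (h : IsPrimitiveRoot ζ n) : ζ ^ 6 + 2 * ζ ^ 5 - ζ ^ 4 - ζ ^ 2 + 2 * ζ + 1 ≠ 0 := by
  intro hζ
  have h0 : ζ ≠ 0 := h.ne_zero hn.ne'
  have hconj : ∀ k : ℕ, k.Coprime n →
      (ζ ^ k + (ζ ^ k)⁻¹) ^ 3 + 2 * (ζ ^ k + (ζ ^ k)⁻¹) ^ 2 - 4 * (ζ ^ k + (ζ ^ k)⁻¹) - 4 = 0 := by
    intro k hk
    apply cubic_add_inv_eq_zero (pow_ne_zero k h0)
    have := h.aeval_pow_eq_zero_of_coprime hk (p := .X ^ 6 + 2 * .X ^ 5 - .X ^ 4 - .X ^ 2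
      + 2 * .X + 1) (by simpa [map_ofNat] using hζ)
    simpa [map_ofNat] using this
  have hy := cubic_add_inv_eq_zero h0 hζ
  have hsq : ζ ^ 2 + (ζ ^ 2)⁻¹ = (ζ + ζ⁻¹) ^ 2 - 2 := by
    field_simp
    ring
  generalize hyd : ζ + ζ⁻¹ = y at hy hsq
  rcases Nat.even_or_odd' n with ⟨m, rfl | rfl⟩
  · have hhalf := h.pow_half_eq_neg_one (by omega)
    rcases Nat.even_or_odd m with hm | hm
    · have hc : (m + 1).Coprime (2 * m) := by
        rw [Nat.coprime_mul_iff_right]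
        exact ⟨Nat.coprime_two_right.mpr hm.add_one, by simp⟩
      have hk := hconj _ hc
      rw [show ζ ^ (m + 1) = -ζ by rw [pow_succ, hhalf]; ring, inv_neg, ← neg_add, hyd] at hk
      have e1 : y ^ 2 = 2 := by linear_combination (hy + hk) / 4
      have e2 : y = 0 := by linear_combination (y + 2) / 2 * e1 - hy / 2
      norm_num [e2] at e1
    · have hc : (m + 2).Coprime (2 * m) := by
        rw [Nat.coprime_mul_iff_right]
        refine ⟨Nat.coprime_two_right.mpr (by grind), ?_⟩
        simpa using Nat.coprime_two_left.mpr hm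
      have hk := hconj _ hc
      rw [show ζ ^ (m + 2) = -ζ ^ 2 by rw [pow_add, hhalf]; ring, inv_neg, ← neg_add, hsq] at hk
      have e1 : 4 * y ^ 2 - 4 * y - 5 = 0 := by
        linear_combination -hk / 4 + (-y ^ 3 + 2 * y ^ 2 + 4) / 4 * hy
      have e2 : y = 1 := by linear_combination 4 * hy - (y + 3) * e1
      norm_num [e2] at e1
  · have hk := hconj 2 (Nat.coprime_two_left.mpr ⟨m, rfl⟩)
    rw [hsq] at hk
    have e1 : 8 * y ^ 2 - 8 * y - 11 = 0 := by
      linear_combination hk / 4 - (y ^ 3 - 2 * y ^ 2 + 4 * y - 12) / 4 * hy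
    have e2 : y = -1 / 3 := by linear_combination (8 * hy - (y + 3) * e1) / 3
    norm_num [e2] at e1

open Polynomial in
/-- No root of unity is a root of `x⁶ + 2x⁵ - x⁴ - x² + 2x + 1`; equivalently, this
polynomial is not divisible by any cyclotomic polynomial. -/
theorem no_root_of_unity_root :
    (∀ ζ : ℂ, (∃ b : ℕ, 0 < b ∧ ζ ^ b = 1) →
      ζ ^ 6 + 2 * ζ ^ 5 - ζ ^ 4 - ζ ^ 2 + 2 * ζ + 1 ≠ 0) ∧
    (∀ b : ℕ, 0 < b →
      ¬ (cyclotomic b ℤ ∣ (X ^ 6 + 2 * X ^ 5 - X ^ 4 - X ^ 2 + 2 * X + 1 : ℤ[X]))) := by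
  have key : ∀ ζ : ℂ, (∃ b : ℕ, 0 < b ∧ ζ ^ b = 1) →
      ζ ^ 6 + 2 * ζ ^ 5 - ζ ^ 4 - ζ ^ 2 + 2 * ζ + 1 ≠ 0 := by
    rintro ζ ⟨b, hb, hζ⟩
    exact sextic_ne_zero_of_isPrimitiveRoot
      (orderOf_pos_iff.mpr (isOfFinOrder_iff_pow_eq_one.mpr ⟨b, hb, hζ⟩))
      (IsPrimitiveRoot.orderOf ζ)
  refine ⟨key, fun b hb ⟨q, hq⟩ => ?_⟩
  have hprim := Complex.isPrimitiveRoot_exp b hb.ne'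
  refine key _ ⟨b, hb, hprim.pow_eq_one⟩ ?_
  have hroot := (hprim.isRoot_cyclotomic hb).eq_zero
  rw [← map_cyclotomic_int, eval_map, ← algebraMap_int_eq, ← aeval_def] at hroot
  simpa [hroot, map_ofNat] using congrArg (aeval (Complex.exp (2 * Real.pi * Complex.I / b))) hq
end
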